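/- Let Λ = U³ ⊕ E8² ⊕ ⟨−2⟩. There exist involutions ι₁, ι₂, ι₃, ι₄ ∈ O(Λ), pairwise non-conjugate in O(Λ), each with invariant sublattice of signature (1,1), such that: Λ^{ι₁} is isometric to U; Λ^{ι₂} is isometric to U(2); Λ^{ι₃} and Λ^{ι₄} are isometric to ⟨2⟩ ⊕ ⟨−2⟩; the element g₃ ∈ Λ^{ι₃} of square −2 satisfies div_Λ(g₃) = 2; and the element g₄ ∈ Λ^{ι₄} of square −2 satisfies div_Λ(g₄) = 1. Moreover, every involution ι ∈ O(Λ) whose invariant sublattice has signature (1,1) is conjugate in O(Λ) to exactly one of ι₁, ι₂, ι₃, ι₄. -/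

import Mathlib

open Matrix

/-- The Gram pairing `(x, y) ↦ xᵀ G y` of an integer matrix `G`, as a bilinear map. -/
def gramBilin {n : ℕ} (G : Matrix (Fin n) (Fin n) ℤ) :
    (Fin n → ℤ) →ₗ[ℤ] (Fin n → ℤ) →ₗ[ℤ] ℤ :=
  Matrix.toLinearMap₂' ℤ G

/-- The hyperbolic plane `U`, with Gram matrix `[[0,1],[1,0]]`. -/
def UGram : Matrix (Fin 2) (Fin 2) ℤ := !![0, 1; 1, 0]

/-- `U(2)`, with Gram matrix `[[0,2],[2,0]]`. -/
def U2Gram : Matrix (Fin 2) (Fin 2) ℤ := !![0, 2; 2, 0]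

/-- `⟨2⟩ ⊕ ⟨-2⟩`. -/
def diag2Gram : Matrix (Fin 2) (Fin 2) ℤ := !![2, 0; 0, -2]

/-- The (negative definite even unimodular) `E8` lattice: the negative of the E₈ Cartan matrix. -/
def E8Gram : Matrix (Fin 8) (Fin 8) ℤ := -CartanMatrix.E₈

/-- The rank-one lattice `⟨k⟩`. -/
def rankOneGram (k : ℤ) : Matrix (Fin 1) (Fin 1) ℤ := !![k]

/-- Orthogonal direct sum of two bilinear forms, on the product module. -/
def prodBilin {M N : Type*} [AddCommGroup M] [AddCommGroup N] [Module ℤ M] [Module ℤ N]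
    (BM : M →ₗ[ℤ] M →ₗ[ℤ] ℤ) (BN : N →ₗ[ℤ] N →ₗ[ℤ] ℤ) :
    (M × N) →ₗ[ℤ] (M × N) →ₗ[ℤ] ℤ :=
  LinearMap.mk₂ ℤ (fun x y => BM x.1 y.1 + BN x.2 y.2)
    (by intro m₁ m₂ n; simp [map_add]; ring)
    (by intro c m n; simp [_root_.map_smul, smul_eq_mul]; ring)
    (by intro m n₁ n₂; simp [map_add]; ring)
    (by intro c m n; simp [_root_.map_smul, smul_eq_mul]; ring)

/-- The underlying module of `Λ = U³ ⊕ E8² ⊕ ⟨-2⟩`. -/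
abbrev LambdaM : Type :=
  (Fin 2 → ℤ) × (Fin 2 → ℤ) × (Fin 2 → ℤ) × (Fin 8 → ℤ) × (Fin 8 → ℤ) × (Fin 1 → ℤ)

/-- The bilinear form of the Beauville–Bogomolov lattice `Λ = U³ ⊕ E8² ⊕ ⟨-2⟩`. -/
def LambdaB : LambdaM →ₗ[ℤ] LambdaM →ₗ[ℤ] ℤ :=
  prodBilin (gramBilin UGram) <| prodBilin (gramBilin UGram) <| prodBilin (gramBilin UGram) <|
    prodBilin (gramBilin E8Gram) <| prodBilin (gramBilin E8Gram) (gramBilin (rankOneGram (-2)))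

/-- Membership in `O(Λ)`: a linear automorphism preserving the form. -/
def IsIsometry (f : LambdaM ≃ₗ[ℤ] LambdaM) : Prop :=
  ∀ x y, LambdaB (f x) (f y) = LambdaB x y

/-- The invariant sublattice `Λ^ι = {x | ι x = x}`. -/
def invLattice (f : LambdaM ≃ₗ[ℤ] LambdaM) : Submodule ℤ LambdaM :=
  LinearMap.eqLocus (f : LambdaM →ₗ[ℤ] LambdaM) (LinearMap.id)

/-- A submodule of `Λ`, with the restricted form, is isometric to the lattice `(N, BN)`. -/
def IsometricTo {N : Type*} [AddCommGroup N] [Module ℤ N]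
    (K : Submodule ℤ LambdaM) (BN : N →ₗ[ℤ] N →ₗ[ℤ] ℤ) : Prop :=
  ∃ e : K ≃ₗ[ℤ] N, ∀ x y : K, BN (e x) (e y) = LambdaB (x : LambdaM) (y : LambdaM)

/-- `div_Λ(v) = d`: the ideal of values `B(v, ·)` is generated by the positive integer `d`. -/
def HasDivisibility (v : LambdaM) (d : ℤ) : Prop :=
  0 < d ∧ (∀ x, d ∣ LambdaB v x) ∧ ∃ x, LambdaB v x = d

/-- Conjugacy in `O(Λ)`: `ι' = γ ∘ ι ∘ γ⁻¹` for some isometry `γ`. -/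
def ConjInO (ι ι' : LambdaM ≃ₗ[ℤ] LambdaM) : Prop :=
  ∃ γ : LambdaM ≃ₗ[ℤ] LambdaM, IsIsometry γ ∧ ∀ x, ι' x = γ (ι (γ.symm x))

/-- A sublattice has signature (1,1): rank two, containing both an element of positive
square and an element of negative square. -/
def SigOneOne (K : Submodule ℤ LambdaM) : Prop :=
  Module.finrank ℤ K = 2 ∧ (∃ x ∈ K, 0 < LambdaB x x) ∧ (∃ x ∈ K, LambdaB x x < 0)

/-- The orthogonal complement of a submodule of `Λ`. -/
def perpOf (K : Submodule ℤ LambdaM) : Submodule ℤ LambdaM where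
  carrier := {x | ∀ s ∈ K, LambdaB x s = 0}
  add_mem' := by
    intro a b ha hb s hs
    simp [map_add, LinearMap.add_apply, ha s hs, hb s hs]
  zero_mem' := by
    intro s hs
    simp
  smul_mem' := by
    intro c a ha s hs
    simp only [_root_.map_smul, LinearMap.smul_apply, ha s hs, smul_zero]

section EvenLattice

variable {L : Type*} [AddCommGroup L] (B : L →ₗ[ℤ] L →ₗ[ℤ] ℤ)

/-- `g` is an isometry of `(L, B)` fixing every element of `S`. -/
def FixIso (S : Set L) (g : L ≃ₗ[ℤ] L) : Prop :=
  (∀ x y, B (g x) (g y) = B x y) ∧ ∀ s ∈ S, g s = s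

/-- The orbit of `v` under the isometries fixing `S` pointwise. -/
def FixOrbit (S : Set L) (v : L) : Set L := {x | ∃ g, FixIso B S g ∧ g v = x}

/-- Orthogonality to every element of `S`. -/
def PerpTo (S : Set L) (x : L) : Prop := ∀ s ∈ S, B x s = 0

variable {B}

theorem FixIso.trans {S : Set L} {g h : L ≃ₗ[ℤ] L} (hg : FixIso B S g) (hh : FixIso B S h) :
    FixIso B S (g.trans h) :=
  ⟨fun x y => by simp [hh.1, hg.1], fun s hs => by simp [hg.2 s hs, hh.2 s hs]⟩

theorem FixIso.mono {S T : Set L} {g : L ≃ₗ[ℤ] L} (hg : FixIso B S g) (h : T ⊆ S) :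
    FixIso B T g := ⟨hg.1, fun s hs => hg.2 s (h hs)⟩

theorem FixIso.perpTo {S : Set L} {g : L ≃ₗ[ℤ] L} (hg : FixIso B S g) {x : L}
    (hx : PerpTo B S x) : PerpTo B S (g x) := fun s hs => by
  rw [← hg.2 s hs, hg.1, hx s hs]

theorem perpTo_add {S : Set L} {x y : L} (hx : PerpTo B S x) (hy : PerpTo B S y) :
    PerpTo B S (x + y) := fun s hs => by simp [hx s hs, hy s hs]

theorem perpTo_smul {S : Set L} {x : L} (c : ℤ) (hx : PerpTo B S x) :
    PerpTo B S (c • x) := fun s hs => by simp [hx s hs]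

theorem self_mem_fixOrbit (S : Set L) (v : L) : v ∈ FixOrbit B S v :=
  ⟨LinearEquiv.refl ℤ L, ⟨fun _ _ => rfl, fun _ _ => rfl⟩, rfl⟩

theorem fixOrbit_trans {S : Set L} {u v w : L} (hv : v ∈ FixOrbit B S u)
    (hw : w ∈ FixOrbit B S v) : w ∈ FixOrbit B S u := by
  obtain ⟨g, hg, rfl⟩ := hv
  obtain ⟨h, hh, rfl⟩ := hw
  exact ⟨g.trans h, hg.trans hh, rfl⟩

theorem fixOrbit_form {S : Set L} {v x : L} (hx : x ∈ FixOrbit B S v) : B x x = B v v := by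
  obtain ⟨g, hg, rfl⟩ := hx
  exact hg.1 v v

theorem fixOrbit_perpTo {S : Set L} {v x : L} (hv : PerpTo B S v) (hx : x ∈ FixOrbit B S v) :
    PerpTo B S x := by
  obtain ⟨g, hg, rfl⟩ := hx
  exact hg.perpTo hv

variable (B) in
/-- The Eichler transvection attached to an isotropic `e`, a vector `w` orthogonal to `e`
and `q` with `B w w = 2 * q`. -/
def eichler (e w : L) (q : ℤ) : L →ₗ[ℤ] L :=
  LinearMap.id + (B e).smulRight w - (B w).smulRight e - (q • B e).smulRight e

theorem eichler_apply (e w : L) (q : ℤ) (x : L) :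
    eichler B e w q x = x + B e x • w - B w x • e - (q * B e x) • e := by
  simp [eichler]

theorem eichler_neg_eichler (hB : ∀ x y, B x y = B y x) {e w : L} {q : ℤ}
    (he : B e e = 0) (hew : B e w = 0) (hw : B w w = 2 * q) (x : L) :
    eichler B e (-w) q (eichler B e w q x) = x := by
  have hwe : B w e = 0 := by rw [hB, hew]
  simp only [eichler_apply, map_add, map_sub, map_neg, map_smul, he, hew, hwe, hw,
    LinearMap.neg_apply]
  module

theorem eichler_isometry (hB : ∀ x y, B x y = B y x) {e w : L} {q : ℤ}
    (he : B e e = 0) (hew : B e w = 0) (hw : B w w = 2 * q) (x y : L) :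
    B (eichler B e w q x) (eichler B e w q y) = B x y := by
  have hwe : B w e = 0 := by rw [hB, hew]
  simp only [eichler_apply, map_add, map_sub, map_smul, smul_eq_mul, he, hew, hwe, hw,
    LinearMap.add_apply, LinearMap.sub_apply, LinearMap.smul_apply, hB x e, hB x w]
  ring

/-- Eichler transvections along vectors orthogonal to `S` fix `S` pointwise. -/
theorem eichler_mem_fixOrbit (hB : ∀ x y, B x y = B y x) {S : Set L} {v x : L}
    (hx : x ∈ FixOrbit B S v) {e w : L} (q : ℤ) (heS : PerpTo B S e) (hwS : PerpTo B S w)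
    (he : B e e = 0) (hew : B e w = 0) (hw : B w w = 2 * q) :
    x + B e x • w - B w x • e - (q * B e x) • e ∈ FixOrbit B S v := by
  refine fixOrbit_trans hx ⟨LinearEquiv.ofLinearMap (eichler B e w q) (eichler B e (-w) q) ?_ ?_,
    ⟨fun x y => eichler_isometry hB he hew hw x y, fun s hs => ?_⟩, eichler_apply e w q x⟩
  · ext x
    have := eichler_neg_eichler (w := -w) (q := q) hB he (by simp [hew]) (by simp [hw]) x
    simpa using this
  · ext x
    exact eichler_neg_eichler hB he hew hw x
  · simp [eichler_apply, heS s hs, hwS s hs]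

variable (B) in
/-- Two orthogonal hyperbolic pairs `(e₁, f₁)`, `(e₂, f₂)`, orthogonal to `S`. -/
structure HypPairs (S : Set L) (e₁ f₁ e₂ f₂ : L) : Prop where
  e₁S : PerpTo B S e₁
  f₁S : PerpTo B S f₁
  e₂S : PerpTo B S e₂
  f₂S : PerpTo B S f₂
  e₁e₁ : B e₁ e₁ = 0
  e₁f₁ : B e₁ f₁ = 1
  e₁e₂ : B e₁ e₂ = 0
  e₁f₂ : B e₁ f₂ = 0
  f₁f₁ : B f₁ f₁ = 0
  f₁e₂ : B f₁ e₂ = 0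
  f₁f₂ : B f₁ f₂ = 0
  e₂e₂ : B e₂ e₂ = 0
  e₂f₂ : B e₂ f₂ = 1
  f₂f₂ : B f₂ f₂ = 0

theorem HypPairs.swap (hB : ∀ x y, B x y = B y x) {S : Set L} {e₁ f₁ e₂ f₂ : L}
    (h : HypPairs B S e₁ f₁ e₂ f₂) : HypPairs B S e₁ f₁ f₂ e₂ where
  e₁S := h.e₁S
  f₁S := h.f₁S
  e₂S := h.f₂S
  f₂S := h.e₂S
  e₁e₁ := h.e₁e₁
  e₁f₁ := h.e₁f₁
  e₁e₂ := h.e₁f₂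
  e₁f₂ := h.e₁e₂
  f₁f₁ := h.f₁f₁
  f₁e₂ := h.f₁f₂
  f₁f₂ := h.f₁e₂
  e₂e₂ := h.f₂f₂
  e₂f₂ := by rw [hB, h.e₂f₂]
  f₂f₂ := h.e₂e₂

/-- Every integer congruent to `B e₂ x` modulo `B f₁ x` is a value of `B f₁` on the orbit. -/
theorem HypPairs.exists_value (hB : ∀ x y, B x y = B y x) {S : Set L} {e₁ f₁ e₂ f₂ : L}
    (h : HypPairs B S e₁ f₁ e₂ f₂) {v x : L} (hx : x ∈ FixOrbit B S v) (m : ℤ) :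
    ∃ x' ∈ FixOrbit B S v, B f₁ x' = B e₂ x + m * B f₁ x := by
  have hf₁e₁ : B f₁ e₁ = 1 := by rw [hB, h.e₁f₁]
  have h1 := eichler_mem_fixOrbit hB hx (e := f₁) (w := (m - 1) • f₂) 0 h.f₁S
    (perpTo_smul _ h.f₂S) h.f₁f₁ (by simp [h.f₁f₂]) (by simp [h.f₂f₂])
  have he₂f₁ : B e₂ f₁ = 0 := by rw [hB, h.f₁e₂]
  have he₂e₁ : B e₂ e₁ = 0 := by rw [hB, h.e₁e₂]
  refine ⟨_, eichler_mem_fixOrbit hB h1 (e := e₂) (w := e₁) 0 h.e₂S h.e₁S h.e₂e₂ he₂e₁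
    (by simp [h.e₁e₁]), ?_⟩
  simp only [map_add, map_sub, map_smul, smul_eq_mul, h.f₁f₁, h.f₁e₂, h.f₁f₂, hf₁e₁, h.e₂f₂,
    he₂f₁]
  ring

/-- Some element of the orbit has all its values divisible by its value against `f₁`. -/
theorem HypPairs.exists_dvd (hB : ∀ x y, B x y = B y x) (hev : ∀ x, ∃ q, B x x = 2 * q)
    {S : Set L} {e₁ f₁ e₂ f₂ : L} (h : HypPairs B S e₁ f₁ e₂ f₂) (v : L) :
    ∃ x ∈ FixOrbit B S v, ∀ y, PerpTo B S y → B f₁ x ∣ B x y := by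
  have hf₁e₁ : B f₁ e₁ = 1 := by rw [hB, h.e₁f₁]
  have he₂f₁ : B e₂ f₁ = 0 := by rw [hB, h.f₁e₂]
  have he₂e₁ : B e₂ e₁ = 0 := by rw [hB, h.e₁e₂]
  have hf₂f₁ : B f₂ f₁ = 0 := by rw [hB, h.f₁f₂]
  have hf₂e₁ : B f₂ e₁ = 0 := by rw [hB, h.e₁f₂]
  have hf₂e₂ : B f₂ e₂ = 1 := by rw [hB, h.e₂f₂]
  -- an element whose value against `f₁` is minimal in absolute value
  have hmin : ∃ x₀ ∈ FixOrbit B S v, ∀ x ∈ FixOrbit B S v, B f₁ x ≠ 0 →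
      B f₁ x₀ ≠ 0 ∧ |B f₁ x₀| ≤ |B f₁ x| := by
    by_cases hz : ∃ x ∈ FixOrbit B S v, B f₁ x ≠ 0
    · have hz' : ∃ n : ℕ, ∃ x ∈ FixOrbit B S v, B f₁ x ≠ 0 ∧ (B f₁ x).natAbs = n := by
        obtain ⟨x, hx, hx0⟩ := hz
        exact ⟨_, x, hx, hx0, rfl⟩
      classical
      obtain ⟨x₀, hx₀, h0, hn⟩ := Nat.find_spec hz'
      refine ⟨x₀, hx₀, fun x hx hx0 => ⟨h0, ?_⟩⟩
      have := Nat.find_min' hz' ⟨x, hx, hx0, rfl⟩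
      rw [← hn] at this
      rw [Int.abs_eq_natAbs, Int.abs_eq_natAbs]
      exact_mod_cast this
    · push Not at hz
      exact ⟨v, self_mem_fixOrbit S v, fun x hx hx0 => absurd (hz x hx) hx0⟩
  obtain ⟨x₀, hx₀, hm⟩ := hmin
  set a := B f₁ x₀ with ha
  have key : ∀ {e f : L}, HypPairs B S e₁ f₁ e f → ∀ x ∈ FixOrbit B S v, B f₁ x = a →
      a ∣ B e x := by
    intro e f hef x hx hxa
    obtain ⟨x', hx', hval⟩ := hef.exists_value hB hx (-(B e x / a))
    rw [hxa] at hval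
    have hval' : B f₁ x' = B e x % a := by
      rw [hval, Int.emod_def]; ring
    by_contra hnd
    have hne : B f₁ x' ≠ 0 := by
      rw [hval']; exact fun hc => hnd (Int.dvd_of_emod_eq_zero hc)
    obtain ⟨ha0, hle⟩ := hm x' hx' hne
    rw [hval', abs_of_nonneg (Int.emod_nonneg _ ha0)] at hle
    exact absurd (Int.emod_lt_abs (B e x) ha0) (not_lt.mpr hle)
  -- normalise so that the value against `e₂` vanishes
  obtain ⟨c, hc⟩ := key h x₀ hx₀ rfl
  have hx₁ := eichler_mem_fixOrbit hB hx₀ (e := f₁) (w := (-c) • f₂) 0 h.f₁S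
    (perpTo_smul _ h.f₂S) h.f₁f₁ (by simp [h.f₁f₂]) (by simp [h.f₂f₂])
  set x₁ := x₀ + B f₁ x₀ • (-c) • f₂ - B ((-c) • f₂) x₀ • f₁ - (0 * B f₁ x₀) • f₁ with hx₁_eq
  have h₁a : B f₁ x₁ = a := by
    simp [hx₁_eq, h.f₁f₂, h.f₁f₁, ha]
  have h₁e : B e₂ x₁ = 0 := by
    simp [hx₁_eq, hc, h.e₂f₂, he₂f₁, ← ha]
  have h₁f : a ∣ B f₂ x₁ := key (h.swap hB) x₁ hx₁ h₁a
  have h₁b : a ∣ B e₁ x₁ := by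
    have hx₂ := eichler_mem_fixOrbit hB hx₁ (e := e₁) (w := e₂) 0 h.e₁S h.e₂S h.e₁e₁ h.e₁e₂
      (by simp [h.e₂e₂])
    have := key (h.swap hB) _ hx₂ (by simp [h.f₁e₂, h₁e, h₁a])
    simpa [hf₂e₂, h₁e, (Int.dvd_add_right h₁f)] using this
  refine ⟨x₁, hx₁, fun y hy => ?_⟩
  obtain ⟨w, hw⟩ : ∃ w, w = y - B e₁ y • f₁ - B f₁ y • e₁ - B e₂ y • f₂ - B f₂ y • e₂ := ⟨_, rfl⟩
  have hwS : PerpTo B S w := by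
    intro s hs
    simp [hw, hy s hs, h.e₁S s hs, h.e₂S s hs, h.f₁S s hs, h.f₂S s hs]
  have hwe₂ : B e₂ w = 0 := by simp [hw, he₂f₁, he₂e₁, h.e₂e₂, h.e₂f₂]
  have hwf₁ : B f₁ w = 0 := by simp [hw, h.f₁f₁, hf₁e₁, h.f₁e₂, h.f₁f₂]
  have hwf₂ : B f₂ w = 0 := by simp [hw, hf₂f₁, hf₂e₁, hf₂e₂, h.f₂f₂]
  obtain ⟨q, hq⟩ := hev w
  have h₁w : a ∣ B w x₁ := by
    have hx₂ := eichler_mem_fixOrbit hB hx₁ (e := e₂) (w := w) q h.e₂S hwS h.e₂e₂ hwe₂ hq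
    have := key (h.swap hB) _ hx₂ (by simp [h.f₁e₂, h₁e, h₁a])
    simpa [hf₂e₂, h₁e, (dvd_sub_right h₁f)] using this
  have hy' : y = w + B e₁ y • f₁ + B f₁ y • e₁ + B e₂ y • f₂ + B f₂ y • e₂ := by
    rw [hw]; module
  have : B x₁ y = B w x₁ + B e₁ y * a + B f₁ y * B e₁ x₁ + B e₂ y * B f₂ x₁ := by
    conv_lhs => rw [hB, hy']
    simp [h₁e, h₁a]
  rw [this, h₁a]
  exact dvd_add (dvd_add (dvd_add h₁w (Dvd.intro_left _ rfl)) (h₁b.mul_left _)) (h₁f.mul_left _)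

/-- If `x` pairs to `1` with `f₁`, it can be moved into the first hyperbolic plane. -/
theorem HypPairs.normal_of_value_one (hB : ∀ x y, B x y = B y x)
    (hev : ∀ x, ∃ q, B x x = 2 * q) {S : Set L} {e₁ f₁ e₂ f₂ : L}
    (h : HypPairs B S e₁ f₁ e₂ f₂) {x : L} (hxS : PerpTo B S x) (hx : B f₁ x = 1) {k : ℤ}
    (hk : B x x = 2 * k) : e₁ + k • f₁ ∈ FixOrbit B S x := by
  have hf₁e₁ : B f₁ e₁ = 1 := by rw [hB, h.e₁f₁]
  obtain ⟨n, hn⟩ : ∃ n, n = x - e₁ - B e₁ x • f₁ := ⟨_, rfl⟩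
  have hnS : PerpTo B S n := by
    intro s hs
    simp [hn, hxS s hs, h.e₁S s hs, h.f₁S s hs]
  have hnf : B f₁ n = 0 := by simp [hn, hx, h.f₁f₁, hf₁e₁]
  obtain ⟨q, hq⟩ := hev n
  have hm := eichler_mem_fixOrbit hB (self_mem_fixOrbit S x) (e := f₁) (w := (-1 : ℤ) • n) q h.f₁S
    (perpTo_smul _ hnS) h.f₁f₁ (by simp [hnf]) (by simp [hq])
  obtain ⟨c, hc⟩ : ∃ c : ℤ, x + B f₁ x • (-1 : ℤ) • n - B ((-1 : ℤ) • n) x • f₁ - (q * B f₁ x) • f₁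
      = e₁ + c • f₁ := by
    refine ⟨B e₁ x + B n x - q, ?_⟩
    rw [hx, map_smul, LinearMap.smul_apply, smul_eq_mul]
    conv_lhs => enter [1, 1, 2, 2, 2]; rw [hn]
    module
  rw [hc] at hm
  have := fixOrbit_form hm
  simp [hk, h.e₁e₁, h.e₁f₁, hf₁e₁, h.f₁f₁] at this
  obtain rfl : c = k := by omega
  exact hm

/-- Eichler's criterion for vectors with a value `1`. -/
theorem HypPairs.normal_of_isUnit (hB : ∀ x y, B x y = B y x)
    (hev : ∀ x, ∃ q, B x x = 2 * q) {S : Set L} {e₁ f₁ e₂ f₂ : L}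
    (h : HypPairs B S e₁ f₁ e₂ f₂) {v y : L} (hvS : PerpTo B S v) (hyS : PerpTo B S y)
    (hvy : B v y = 1) {k : ℤ} (hk : B v v = 2 * k) : e₁ + k • f₁ ∈ FixOrbit B S v := by
  obtain ⟨x, hx, hdvd⟩ := h.exists_dvd hB hev v
  have hu : IsUnit (B f₁ x) := by
    obtain ⟨g, hg, rfl⟩ := hx
    have := hdvd _ (hg.perpTo hyS)
    rw [hg.1, hvy] at this
    exact isUnit_of_dvd_one this
  obtain ⟨x', hx', h1⟩ : ∃ x' ∈ FixOrbit B S v, B f₁ x' = 1 := by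
    rcases Int.isUnit_iff.mp hu with h1 | h1
    · exact ⟨x, hx, h1⟩
    · obtain ⟨x', hx', hv⟩ := h.exists_value hB hx (B e₂ x - 1)
      exact ⟨x', hx', by rw [hv, h1]; ring⟩
  exact fixOrbit_trans hx' (h.normal_of_value_one hB hev (fixOrbit_perpTo hvS hx') h1
    (by rw [fixOrbit_form hx', hk]))

end EvenLattice

section InvariantPlane

variable {L : Type*} [AddCommGroup L] (B : L →ₗ[ℤ] L →ₗ[ℤ] ℤ)

/-- The map `x ↦ φ x - x`, where `φ` sends `x` to the combination of `p, q` with coefficient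
matrix `[[α, β], [β, γ]]` applied to `(B p x, B q x)`. -/
def planeMap (p q : L) (α β γ : ℤ) : L →ₗ[ℤ] L :=
  (B p).smulRight (α • p + β • q) + (B q).smulRight (β • p + γ • q) - LinearMap.id

/-- The matrix `[[α, β], [β, γ]]` is twice the inverse of the Gram matrix of `p, q`. -/
structure GramInv (p q : L) (α β γ : ℤ) : Prop where
  h₁₁ : α * B p p + β * B p q = 2
  h₂₁ : β * B p p + γ * B p q = 0
  h₁₂ : α * B p q + β * B q q = 0
  h₂₂ : β * B p q + γ * B q q = 2

/-- `p, q` generate the invariant sublattice of `f`. -/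
structure InvSpan (f : L ≃ₗ[ℤ] L) (p q : L) : Prop where
  left : f p = p
  right : f q = q
  span : ∀ x, f x = x → ∃ m n : ℤ, x = m • p + n • q

variable {B}

theorem planeMap_apply (p q : L) (α β γ : ℤ) (x : L) :
    planeMap B p q α β γ x = B p x • (α • p + β • q) + B q x • (β • p + γ • q) - x := by
  simp [planeMap]

variable {p q : L} {α β γ : ℤ}

theorem GramInv.det_ne_zero (h : GramInv B p q α β γ) : B p p * B q q - B p q ^ 2 ≠ 0 := by
  intro h0
  have h4 : (α * γ - β ^ 2) * (B p p * B q q - B p q ^ 2) = 4 := by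
    linear_combination (γ * B q q + β * B p q) * h.h₁₁ - (γ * B p q + β * B p p) * h.h₁₂
      + 2 * h.h₂₂
  rw [h0] at h4
  omega

theorem GramInv.apply_left (h : GramInv B p q α β γ) (x : L) :
    B p (planeMap B p q α β γ x) = B p x := by
  simp only [planeMap_apply, map_add, map_sub, map_smul, smul_eq_mul]
  linear_combination B p x * h.h₁₁ + B q x * h.h₂₁

theorem GramInv.apply_right (hB : ∀ x y, B x y = B y x) (h : GramInv B p q α β γ) (x : L) :
    B q (planeMap B p q α β γ x) = B q x := by
  simp only [planeMap_apply, map_add, map_sub, map_smul, smul_eq_mul, hB q p]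
  linear_combination B p x * h.h₁₂ + B q x * h.h₂₂

theorem GramInv.involutive (hB : ∀ x y, B x y = B y x) (h : GramInv B p q α β γ) :
    Function.Involutive (planeMap B p q α β γ) := by
  intro x
  rw [planeMap_apply, h.apply_left, h.apply_right hB, planeMap_apply]
  abel

theorem GramInv.isometry (hB : ∀ x y, B x y = B y x) (h : GramInv B p q α β γ) (x y : L) :
    B (planeMap B p q α β γ x) (planeMap B p q α β γ y) = B x y := by
  have h1 : ∀ z, B (planeMap B p q α β γ x) z =
      B p x * (α * B p z + β * B q z) + B q x * (β * B p z + γ * B q z) - B x z := by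
    intro z
    simp [planeMap_apply, mul_add]
  rw [h1, h.apply_left, h.apply_right hB]
  simp only [planeMap_apply, map_add, map_sub, map_smul, smul_eq_mul, hB x p, hB x q]
  ring

theorem GramInv.map_left (hB : ∀ x y, B x y = B y x) (h : GramInv B p q α β γ) :
    planeMap B p q α β γ p = p := by
  have : planeMap B p q α β γ p =
      (α * B p p + β * B p q - 1) • p + (β * B p p + γ * B p q) • q := by
    rw [planeMap_apply, hB q p]; module
  rw [this, h.h₁₁, h.h₂₁]; module

theorem GramInv.map_right (h : GramInv B p q α β γ) :
    planeMap B p q α β γ q = q := by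
  have : planeMap B p q α β γ q =
      (α * B p q + β * B q q) • p + (β * B p q + γ * B q q - 1) • q := by
    rw [planeMap_apply]; module
  rw [this, h.h₁₂, h.h₂₂]; module

/-- The involution acting as the identity on the plane spanned by `p, q` and as `-1` on its
orthogonal complement. -/
def planeInvolution (hB : ∀ x y, B x y = B y x) (h : GramInv B p q α β γ) : L ≃ₗ[ℤ] L :=
  LinearEquiv.ofInvolutive (planeMap B p q α β γ) (h.involutive hB)

theorem planeInvolution_apply (hB : ∀ x y, B x y = B y x) (h : GramInv B p q α β γ) (x : L) :
    planeInvolution hB h x = planeMap B p q α β γ x := rfl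

/-- An isometric involution is determined by a basis of its invariant plane. -/
theorem InvSpan.eq_planeMap (hB : ∀ x y, B x y = B y x) {f : L ≃ₗ[ℤ] L}
    (hf : ∀ x y, B (f x) (f y) = B x y) (hff : ∀ x, f (f x) = x) (hs : InvSpan f p q)
    (h : GramInv B p q α β γ) (y : L) : f y = planeMap B p q α β γ y := by
  obtain ⟨m, n, hmn⟩ := hs.span (f y + y) (by rw [map_add, hff, add_comm])
  have h1 : m * B p p + n * B p q = 2 * B p y := by
    have : B p (f y + y) = 2 * B p y := by
      rw [map_add]; nth_rewrite 1 [← hs.left]; rw [hf]; ring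
    rw [← this, hmn]; simp
  have h2 : m * B p q + n * B q q = 2 * B q y := by
    have : B q (f y + y) = 2 * B q y := by
      rw [map_add]; nth_rewrite 1 [← hs.right]; rw [hf]; ring
    rw [← this, hmn]; simp [hB q p]
  have hm : m = α * B p y + β * B q y := by
    have : 2 * m = 2 * (α * B p y + β * B q y) := by
      linear_combination α * h1 + β * h2 - m * h.h₁₁ - n * h.h₁₂
    omega
  have hn : n = β * B p y + γ * B q y := by
    have : 2 * n = 2 * (β * B p y + γ * B q y) := by
      linear_combination β * h1 + γ * h2 - m * h.h₂₁ - n * h.h₂₂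
    omega
  rw [eq_sub_of_add_eq hmn, planeMap_apply, hm, hn]
  module

theorem planeInvolution_conj (hB : ∀ x y, B x y = B y x) (h : GramInv B p q α β γ)
    {f g : L ≃ₗ[ℤ] L} (hf : ∀ x y, B (f x) (f y) = B x y) (hff : ∀ x, f (f x) = x)
    {p' q' : L} (hs : InvSpan f p' q') (hg : ∀ x y, B (g x) (g y) = B x y)
    (hp : g p' = p) (hq : g q' = q) (x : L) : planeInvolution hB h x = g (f (g.symm x)) := by
  have h' : GramInv B p' q' α β γ := by
    obtain ⟨h1, h2, h3, h4⟩ := h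
    rw [← hp, ← hq] at h1 h2 h3 h4
    simp only [hg] at h1 h2 h3 h4
    exact ⟨h1, h2, h3, h4⟩
  obtain ⟨y, rfl⟩ := g.surjective x
  rw [g.symm_apply_apply, hs.eq_planeMap hB hf hff h', planeInvolution_apply, planeMap_apply,
    planeMap_apply, ← hp, ← hq]
  simp [hg]

theorem coeff_eq_zero (hB : ∀ x y, B x y = B y x) (hD : B p p * B q q - B p q ^ 2 ≠ 0) {m n : ℤ}
    (h : m • p + n • q = 0) : m = 0 ∧ n = 0 := by
  have h1 : m * B p p + n * B p q = 0 := by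
    have := congrArg (B p) h; simpa using this
  have h2 : m * B p q + n * B q q = 0 := by
    have := congrArg (B q) h; simpa [hB q p] using this
  constructor
  · refine (mul_eq_zero.mp ?_).resolve_right hD
    linear_combination B q q * h1 - B p q * h2
  · refine (mul_eq_zero.mp ?_).resolve_right hD
    linear_combination B p p * h2 - B p q * h1

/-- Coordinates on the invariant lattice with respect to a nondegenerate spanning pair. -/
theorem InvSpan.exists_equiv (hB : ∀ x y, B x y = B y x) {f : L ≃ₗ[ℤ] L} (hs : InvSpan f p q)
    (hD : B p p * B q q - B p q ^ 2 ≠ 0) :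
    ∃ e : (Fin 2 → ℤ) ≃ₗ[ℤ] LinearMap.eqLocus (f : L →ₗ[ℤ] L) LinearMap.id,
      ∀ c, (e c : L) = c 0 • p + c 1 • q := by
  let F : (Fin 2 → ℤ) →ₗ[ℤ] LinearMap.eqLocus (f : L →ₗ[ℤ] L) LinearMap.id :=
    LinearMap.codRestrict _ ((LinearMap.proj 0).smulRight p + (LinearMap.proj 1).smulRight q)
      (fun c => by simp [LinearMap.mem_eqLocus, hs.left, hs.right])
  have hF : ∀ c, (F c : L) = c 0 • p + c 1 • q := fun c => rfl
  refine ⟨LinearEquiv.ofBijective F ⟨?_, ?_⟩, hF⟩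
  · rw [injective_iff_map_eq_zero]
    intro c hc
    have h0 : c 0 • p + c 1 • q = 0 := by rw [← hF, hc]; rfl
    obtain ⟨h1, h2⟩ := coeff_eq_zero hB hD h0
    ext i
    fin_cases i
    · exact h1
    · exact h2
  · rintro ⟨x, hx⟩
    obtain ⟨m, n, h⟩ := hs.span x hx
    exact ⟨![m, n], Subtype.ext (by rw [hF]; simp [h])⟩

/-- Functionals on the whole lattice dual to a basis of the invariant plane. -/
theorem InvSpan.exists_dual [Module.Free ℤ L] [Module.Finite ℤ L]
    (hB : ∀ x y, B x y = B y x) {f : L ≃ₗ[ℤ] L} (hs : InvSpan f p q)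
    (hD : B p p * B q q - B p q ^ 2 ≠ 0) :
    ∃ φ ψ : L →ₗ[ℤ] ℤ, φ p = 1 ∧ φ q = 0 ∧ ψ p = 0 ∧ ψ q = 1 := by
  obtain ⟨e, he⟩ := hs.exists_equiv hB hD
  let d : L →ₗ[ℤ] L := (f : L →ₗ[ℤ] L) - LinearMap.id
  obtain ⟨s, hsec⟩ := Module.projective_lifting_property d.rangeRestrict LinearMap.id
    d.surjective_rangeRestrict
  have hmem : ∀ x, x - s (d.rangeRestrict x) ∈ LinearMap.eqLocus (f : L →ₗ[ℤ] L) LinearMap.id := by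
    intro x
    have h1 : d.rangeRestrict (s (d.rangeRestrict x)) = d.rangeRestrict x :=
      LinearMap.congr_fun hsec _
    have h2 : d (x - s (d.rangeRestrict x)) = 0 := by
      rw [map_sub, sub_eq_zero]
      exact (congrArg Subtype.val h1).symm
    rw [LinearMap.mem_eqLocus, ← sub_eq_zero]
    exact h2
  let ρ : L →ₗ[ℤ] LinearMap.eqLocus (f : L →ₗ[ℤ] L) LinearMap.id :=
    LinearMap.codRestrict _ (LinearMap.id - s ∘ₗ d.rangeRestrict) hmem
  have hρ : ∀ c, ρ (c 0 • p + c 1 • q) = e c := by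
    intro c
    apply Subtype.ext
    have h0 : d.rangeRestrict (c 0 • p + c 1 • q) = 0 :=
      Subtype.ext (by simp [d, hs.left, hs.right])
    change (c 0 • p + c 1 • q) - s (d.rangeRestrict (c 0 • p + c 1 • q)) = _
    rw [h0, he, map_zero, sub_zero]
  have hp : e.symm (ρ p) = ![1, 0] := by
    have := hρ ![1, 0]
    rw [e.symm_apply_eq, ← this]; simp
  have hq : e.symm (ρ q) = ![0, 1] := by
    have := hρ ![0, 1]
    rw [e.symm_apply_eq, ← this]; simp
  refine ⟨LinearMap.proj 0 ∘ₗ e.symm.toLinearMap ∘ₗ ρ, LinearMap.proj 1 ∘ₗ e.symm.toLinearMap ∘ₗ ρ,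
    ?_, ?_, ?_, ?_⟩ <;> simp [hp, hq]

/-- A unimodular change of basis of the invariant plane. -/
theorem InvSpan.change {f : L ≃ₗ[ℤ] L} (hs : InvSpan f p q) {x y z w ε : ℤ}
    (hε : ε * ε = 1) (hdet : x * w - y * z = ε) :
    InvSpan f (x • p + y • q) (z • p + w • q) where
  left := by simp [hs.left, hs.right]
  right := by simp [hs.left, hs.right]
  span := by
    intro v hv
    obtain ⟨m, n, rfl⟩ := hs.span v hv
    refine ⟨ε * (m * w - n * z), ε * (n * x - m * y), ?_⟩
    have h1 : ε * (m * w - n * z) * x + ε * (n * x - m * y) * z = m := by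
      linear_combination ε * m * hdet + m * hε
    have h2 : ε * (m * w - n * z) * y + ε * (n * x - m * y) * w = n := by
      linear_combination ε * n * hdet + n * hε
    calc m • p + n • q = (ε * (m * w - n * z) * x + ε * (n * x - m * y) * z) • p
          + (ε * (m * w - n * z) * y + ε * (n * x - m * y) * w) • q := by rw [h1, h2]
      _ = _ := by module

end InvariantPlane

theorem exists_coprime_factor {i j : ℤ} (h : i ≠ 0 ∨ j ≠ 0) :
    ∃ d i' j' x y : ℤ, d ≠ 0 ∧ i = d * i' ∧ j = d * j' ∧ i' * x - j' * y = 1 := by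
  have hd : (Int.gcd i j : ℤ) ≠ 0 := by
    rw [Ne, Int.natCast_eq_zero, Int.gcd_eq_zero_iff]; tauto
  obtain ⟨i', hi⟩ := Int.gcd_dvd_left (a := i) (b := j)
  obtain ⟨j', hj⟩ := Int.gcd_dvd_right (a := i) (b := j)
  refine ⟨Int.gcd i j, i', j', Int.gcdA i j, -Int.gcdB i j, hd, hi, hj, ?_⟩
  apply mul_left_cancel₀ hd
  have := Int.gcd_eq_gcd_ab i j
  linear_combination -this - Int.gcdA i j * hi - Int.gcdB i j * hj

/-- Reduction of a binary quadratic form `r X² + s X Y + u Y²` whose discriminant is a nonzero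
square `m²`: there is a basis in which it becomes `m X Y + k Y²` with `0 ≤ k < m`. -/
theorem binary_form_reduction {r s u m : ℤ} (hm : 0 < m) (hD : s ^ 2 - 4 * r * u = m ^ 2) :
    ∃ x y z w ε k : ℤ, ε * ε = 1 ∧ x * w - y * z = ε ∧ r * x ^ 2 + s * x * y + u * y ^ 2 = 0 ∧
      2 * r * x * z + s * (x * w + y * z) + 2 * u * y * w = m ∧
      r * z ^ 2 + s * z * w + u * w ^ 2 = k ∧ 0 ≤ k ∧ k < m := by
  -- a primitive isotropic vector, completed to a basis
  obtain ⟨x, y, z, w, hdet, hiso⟩ : ∃ x y z w : ℤ, x * w - y * z = 1 ∧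
      r * x ^ 2 + s * x * y + u * y ^ 2 = 0 := by
    by_cases hr : r = 0
    · exact ⟨1, 0, 0, 1, by ring, by rw [hr]; ring⟩
    · obtain ⟨d, x, y, w, z, hd, hx, hy, h1⟩ :=
        exists_coprime_factor (i := m - s) (j := 2 * r) (Or.inr (by omega))
      refine ⟨x, y, z, w, h1, ?_⟩
      have h2 : (4 * r * d ^ 2) * (r * x ^ 2 + s * x * y + u * y ^ 2) = 0 := by
        have e1 : r * (m - s) ^ 2 + s * (m - s) * (2 * r) + u * (2 * r) ^ 2 = 0 := by
          linear_combination -r * hD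
        rw [hx, hy] at e1
        linear_combination 4 * r * e1
      refine (mul_eq_zero.mp h2).resolve_left (by positivity)
  obtain ⟨c, hc⟩ : ∃ c, c = 2 * r * x * z + s * (x * w + y * z) + 2 * u * y * w := ⟨_, rfl⟩
  have hc2 : c ^ 2 = m ^ 2 := by
    rw [hc, ← hD]
    linear_combination (4 * (r * z ^ 2 + s * z * w + u * w ^ 2)) * hiso
      + (s ^ 2 - 4 * r * u) * (x * w - y * z + 1) * hdet
  obtain ⟨ε, hε, hεc⟩ : ∃ ε : ℤ, ε * ε = 1 ∧ ε * c = m := by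
    rcases sq_eq_sq_iff_eq_or_eq_neg.mp hc2 with h | h
    · exact ⟨1, by norm_num, by omega⟩
    · exact ⟨-1, by norm_num, by omega⟩
  obtain ⟨k, hk⟩ : ∃ k, k = r * z ^ 2 + s * z * w + u * w ^ 2 := ⟨_, rfl⟩
  obtain ⟨j, hj⟩ : ∃ j, j = -(k / m) * ε := ⟨_, rfl⟩
  refine ⟨x, y, ε * (z + j * x), ε * (w + j * y), ε, k % m, hε, ?_, hiso, ?_, ?_,
    Int.emod_nonneg _ hm.ne', Int.emod_lt_of_pos _ hm⟩
  · linear_combination ε * hdet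
  · linear_combination hεc - ε * hc + 2 * ε * j * hiso
  · rw [Int.emod_def]
    have hjc : j * c = -(k / m) * m := by rw [hj, ← hεc]; ring
    linear_combination (r * (z + j * x) ^ 2 + s * (z + j * x) * (w + j * y) + u * (w + j * y) ^ 2)
      * hε + j ^ 2 * hiso - hk + hjc - j * hc

theorem gramBilin_apply {n : ℕ} (G : Matrix (Fin n) (Fin n) ℤ) (x y : Fin n → ℤ) :
    gramBilin G x y = x ⬝ᵥ G *ᵥ y := by
  rw [gramBilin, Matrix.toLinearMap₂'_apply']

theorem gramBilin_symm {n : ℕ} {G : Matrix (Fin n) (Fin n) ℤ} (hG : Gᵀ = G) (x y : Fin n → ℤ) :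
    gramBilin G x y = gramBilin G y x := by
  rw [gramBilin_apply, gramBilin_apply, dotProduct_comm, Matrix.dotProduct_mulVec,
    ← Matrix.mulVec_transpose, hG]

theorem gramBilin_represents {n : ℕ} {G : Matrix (Fin n) (Fin n) ℤ} (hG : IsUnit G.det)
    (φ : (Fin n → ℤ) →ₗ[ℤ] ℤ) : ∃ y, ∀ x, gramBilin G y x = φ x := by
  refine ⟨(fun i => φ (Pi.single i 1)) ᵥ* G⁻¹, fun x => ?_⟩
  rw [gramBilin_apply, Matrix.dotProduct_mulVec, Matrix.vecMul_vecMul,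
    Matrix.nonsing_inv_mul _ hG, Matrix.vecMul_one, LinearMap.pi_apply_eq_sum_univ φ x]
  refine Finset.sum_congr rfl fun i _ => ?_
  have : (Pi.single i 1 : Fin n → ℤ) = fun j => if i = j then 1 else 0 := by
    ext j
    simp [Pi.single_apply, eq_comm]
  simp [this, mul_comm]

theorem prodBilin_represents {M N : Type*} [AddCommGroup M] [AddCommGroup N] [Module ℤ M]
    [Module ℤ N] {BM : M →ₗ[ℤ] M →ₗ[ℤ] ℤ} {BN : N →ₗ[ℤ] N →ₗ[ℤ] ℤ} (φ : M × N →ₗ[ℤ] ℤ)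
    (hM : ∃ y, ∀ x, BM y x = φ (x, 0)) (hN : ∃ y, ∀ x, BN y x = φ (0, x)) :
    ∃ y, ∀ x, prodBilin BM BN y x = φ x := by
  obtain ⟨y, hy⟩ := hM
  obtain ⟨z, hz⟩ := hN
  refine ⟨(y, z), fun x => ?_⟩
  rw [prodBilin, LinearMap.mk₂_apply, hy, hz, ← map_add]
  simp

theorem isUnit_det_UGram : IsUnit UGram.det := by
  rw [UGram, Matrix.det_fin_two_of]; decide

theorem isUnit_det_E8Gram : IsUnit E8Gram.det := by
  rw [E8Gram, Matrix.det_neg, CartanMatrix.E₈_det]; decide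

theorem gramBilin_UGram (x y : Fin 2 → ℤ) : gramBilin UGram x y = x 0 * y 1 + x 1 * y 0 := by
  simp [gramBilin_apply, UGram, dotProduct, Fin.sum_univ_two, Matrix.mulVec]

theorem gramBilin_rankOneGram (x y : Fin 1 → ℤ) (k : ℤ) :
    gramBilin (rankOneGram k) x y = k * x 0 * y 0 := by
  simp [gramBilin_apply, rankOneGram, dotProduct, Matrix.mulVec]; ring

theorem gramBilin_E8Gram_even (x : Fin 8 → ℤ) : ∃ q, gramBilin E8Gram x x = 2 * q := by
  refine ⟨-(x 0 ^ 2 + x 1 ^ 2 + x 2 ^ 2 + x 3 ^ 2 + x 4 ^ 2 + x 5 ^ 2 + x 6 ^ 2 + x 7 ^ 2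
    - x 0 * x 2 - x 1 * x 3 - x 2 * x 3 - x 3 * x 4 - x 4 * x 5 - x 5 * x 6 - x 6 * x 7), ?_⟩
  simp [gramBilin_apply, E8Gram, CartanMatrix.E₈, dotProduct, Matrix.mulVec, Fin.sum_univ_succ]
  ring

theorem LambdaB_apply (x y : LambdaM) : LambdaB x y =
    (x.1 0 * y.1 1 + x.1 1 * y.1 0) + (x.2.1 0 * y.2.1 1 + x.2.1 1 * y.2.1 0)
      + (x.2.2.1 0 * y.2.2.1 1 + x.2.2.1 1 * y.2.2.1 0)
      + gramBilin E8Gram x.2.2.2.1 y.2.2.2.1 + gramBilin E8Gram x.2.2.2.2.1 y.2.2.2.2.1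
      - 2 * x.2.2.2.2.2 0 * y.2.2.2.2.2 0 := by
  simp only [LambdaB, prodBilin, LinearMap.mk₂_apply, gramBilin_UGram, gramBilin_rankOneGram]
  ring

theorem LambdaB_symm (x y : LambdaM) : LambdaB x y = LambdaB y x := by
  have hE : E8Gramᵀ = E8Gram := by rw [E8Gram, Matrix.transpose_neg, CartanMatrix.E₈_transpose]
  rw [LambdaB_apply, LambdaB_apply, gramBilin_symm hE x.2.2.2.1, gramBilin_symm hE x.2.2.2.2.1]
  ring

theorem LambdaB_even (x : LambdaM) : ∃ q, LambdaB x x = 2 * q := by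
  obtain ⟨a, ha⟩ := gramBilin_E8Gram_even x.2.2.2.1
  obtain ⟨b, hb⟩ := gramBilin_E8Gram_even x.2.2.2.2.1
  refine ⟨x.1 0 * x.1 1 + x.2.1 0 * x.2.1 1 + x.2.2.1 0 * x.2.2.1 1 + a + b
    - x.2.2.2.2.2 0 * x.2.2.2.2.2 0, ?_⟩
  rw [LambdaB_apply, ha, hb]
  ring

/-- The first isotropic generator of the first hyperbolic plane. -/
def lamE₁ : LambdaM := (![1, 0], 0, 0, 0, 0, 0)

/-- The second isotropic generator of the first hyperbolic plane. -/
def lamF₁ : LambdaM := (![0, 1], 0, 0, 0, 0, 0)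

/-- The first isotropic generator of the second hyperbolic plane. -/
def lamE₂ : LambdaM := (0, ![1, 0], 0, 0, 0, 0)

/-- The second isotropic generator of the second hyperbolic plane. -/
def lamF₂ : LambdaM := (0, ![0, 1], 0, 0, 0, 0)

/-- The first isotropic generator of the third hyperbolic plane. -/
def lamE₃ : LambdaM := (0, 0, ![1, 0], 0, 0, 0)

/-- The second isotropic generator of the third hyperbolic plane. -/
def lamF₃ : LambdaM := (0, 0, ![0, 1], 0, 0, 0)

/-- The generator of the summand `⟨-2⟩`. -/
def lamδ : LambdaM := (0, 0, 0, 0, 0, ![1])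

theorem lamE₁_pair (x : LambdaM) : LambdaB lamE₁ x = x.1 1 := by simp [LambdaB_apply, lamE₁]
theorem lamF₁_pair (x : LambdaM) : LambdaB lamF₁ x = x.1 0 := by simp [LambdaB_apply, lamF₁]
theorem lamE₂_pair (x : LambdaM) : LambdaB lamE₂ x = x.2.1 1 := by simp [LambdaB_apply, lamE₂]
theorem lamF₂_pair (x : LambdaM) : LambdaB lamF₂ x = x.2.1 0 := by simp [LambdaB_apply, lamF₂]
theorem lamE₃_pair (x : LambdaM) : LambdaB lamE₃ x = x.2.2.1 1 := by simp [LambdaB_apply, lamE₃]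
theorem lamF₃_pair (x : LambdaM) : LambdaB lamF₃ x = x.2.2.1 0 := by simp [LambdaB_apply, lamF₃]
theorem lamδ_pair (x : LambdaM) : LambdaB lamδ x = -2 * x.2.2.2.2.2 0 := by
  simp [LambdaB_apply, lamδ]

theorem hypPairs_empty : HypPairs LambdaB ∅ lamE₁ lamF₁ lamE₂ lamF₂ := by
  constructor <;> simp [PerpTo, lamE₁_pair, lamF₁_pair, lamE₂_pair, lamF₂_pair] <;>
    simp [lamE₁, lamF₁, lamE₂, lamF₂]

theorem hypPairs_δ : HypPairs LambdaB {lamδ} lamE₁ lamF₁ lamE₂ lamF₂ := by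
  constructor <;> simp [PerpTo, lamE₁_pair, lamF₁_pair, lamE₂_pair, lamF₂_pair] <;>
    simp [lamE₁, lamF₁, lamE₂, lamF₂, lamδ]

theorem hypPairs_plane : HypPairs LambdaB {lamE₁, lamF₁} lamE₂ lamF₂ lamE₃ lamF₃ := by
  constructor <;> simp [PerpTo, lamE₂_pair, lamF₂_pair, lamE₃_pair, lamF₃_pair] <;>
    simp [lamE₁, lamF₁, lamE₂, lamF₂, lamE₃, lamF₃]

/-- A functional that is even on `δ` is represented by an element of `Λ`. -/
theorem LambdaB_represents (φ : LambdaM →ₗ[ℤ] ℤ) (hφ : 2 ∣ φ lamδ) :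
    ∃ y, ∀ x, LambdaB y x = φ x := by
  have key {n : ℕ} {G : Matrix (Fin n) (Fin n) ℤ} (hG : IsUnit G.det)
      (i : (Fin n → ℤ) →ₗ[ℤ] LambdaM) : ∃ y, ∀ x, gramBilin G y x = φ (i x) :=
    gramBilin_represents hG (φ ∘ₗ i)
  obtain ⟨c, hc⟩ := hφ
  have hlast : ∃ y, ∀ x, gramBilin (rankOneGram (-2)) y x = φ (0, 0, 0, 0, 0, x) := by
    refine ⟨![-c], fun x => ?_⟩
    have : ((0, 0, 0, 0, 0, x) : LambdaM) = x 0 • lamδ := by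
      simp only [lamδ, Prod.smul_mk, smul_zero]
      congr
      ext i
      fin_cases i
      simp
    rw [this, map_smul, hc, gramBilin_rankOneGram]
    simp
    ring
  exact prodBilin_represents φ (key isUnit_det_UGram (LinearMap.inl ℤ _ _)) <|
    prodBilin_represents (φ ∘ₗ LinearMap.inr ℤ _ _)
      (key isUnit_det_UGram (LinearMap.inr ℤ _ _ ∘ₗ LinearMap.inl ℤ _ _)) <|
    prodBilin_represents (φ ∘ₗ LinearMap.inr ℤ _ _ ∘ₗ LinearMap.inr ℤ _ _)
      (key isUnit_det_UGram (LinearMap.inr ℤ _ _ ∘ₗ LinearMap.inr ℤ _ _ ∘ₗ LinearMap.inl ℤ _ _)) <|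
    prodBilin_represents
      (φ ∘ₗ LinearMap.inr ℤ _ _ ∘ₗ LinearMap.inr ℤ _ _ ∘ₗ LinearMap.inr ℤ _ _)
      (key isUnit_det_E8Gram (LinearMap.inr ℤ _ _ ∘ₗ LinearMap.inr ℤ _ _ ∘ₗ LinearMap.inr ℤ _ _
        ∘ₗ LinearMap.inl ℤ _ _)) <|
    prodBilin_represents
      (φ ∘ₗ LinearMap.inr ℤ _ _ ∘ₗ LinearMap.inr ℤ _ _ ∘ₗ LinearMap.inr ℤ _ _
        ∘ₗ LinearMap.inr ℤ _ _)
      (key isUnit_det_E8Gram (LinearMap.inr ℤ _ _ ∘ₗ LinearMap.inr ℤ _ _ ∘ₗ LinearMap.inr ℤ _ _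
        ∘ₗ LinearMap.inr ℤ _ _ ∘ₗ LinearMap.inl ℤ _ _)) hlast

/-- A vector all of whose values are even is a multiple of `δ` modulo `2Λ`. -/
theorem eq_of_forall_even {v : LambdaM} (hv : ∀ y, 2 ∣ LambdaB v y) :
    ∃ (z : LambdaM) (k : ℤ), v = (2 : ℤ) • z + k • lamδ ∧ LambdaB lamδ z = 0 := by
  have key (φ : LambdaM →ₗ[ℤ] ℤ) (hφ : φ lamδ = 0) : 2 ∣ φ v := by
    obtain ⟨y, hy⟩ := LambdaB_represents φ (by simp [hφ])
    rw [← hy, LambdaB_symm]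
    exact hv y
  have h1 i := key (LinearMap.proj i ∘ₗ LinearMap.fst ℤ _ _) (by simp [lamδ])
  have h2 i := key (LinearMap.proj i ∘ₗ LinearMap.fst ℤ _ _ ∘ₗ LinearMap.snd ℤ _ _)
    (by simp [lamδ])
  have h3 i := key (LinearMap.proj i ∘ₗ LinearMap.fst ℤ _ _ ∘ₗ LinearMap.snd ℤ _ _ ∘ₗ
    LinearMap.snd ℤ _ _) (by simp [lamδ])
  have h4 i := key (LinearMap.proj i ∘ₗ LinearMap.fst ℤ _ _ ∘ₗ LinearMap.snd ℤ _ _ ∘ₗ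
    LinearMap.snd ℤ _ _ ∘ₗ LinearMap.snd ℤ _ _) (by simp [lamδ])
  have h5 i := key (LinearMap.proj i ∘ₗ LinearMap.fst ℤ _ _ ∘ₗ LinearMap.snd ℤ _ _ ∘ₗ
    LinearMap.snd ℤ _ _ ∘ₗ LinearMap.snd ℤ _ _ ∘ₗ LinearMap.snd ℤ _ _) (by simp [lamδ])
  simp only [LinearMap.comp_apply, LinearMap.proj_apply, LinearMap.fst_apply,
    LinearMap.snd_apply] at h1 h2 h3 h4 h5
  choose a ha using h1
  choose b hb using h2
  choose c hc using h3
  choose d hd using h4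
  choose e he using h5
  refine ⟨(a, b, c, d, e, 0), v.2.2.2.2.2 0, ?_, by simp [lamδ_pair]⟩
  refine Prod.ext (funext fun i => ?_) (Prod.ext (funext fun i => ?_) (Prod.ext (funext fun i => ?_)
    (Prod.ext (funext fun i => ?_) (Prod.ext (funext fun i => ?_) (funext fun i => ?_)))))
  · simp [lamδ, ha]
  · simp [lamδ, hb]
  · simp [lamδ, hc]
  · simp [lamδ, hd]
  · simp [lamδ, he]
  · fin_cases i
    simp [lamδ]

section Involutions

theorem GramInv.invSpan {L : Type*} [AddCommGroup L] [Module.Free ℤ L] {B : L →ₗ[ℤ] L →ₗ[ℤ] ℤ}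
    {p q : L} {α β γ : ℤ} (hB : ∀ x y, B x y = B y x) (h : GramInv B p q α β γ)
    {φ ψ : L →ₗ[ℤ] ℤ} (hφp : φ p = 1) (hφq : φ q = 0) (hψp : ψ p = 0) (hψq : ψ q = 1) :
    InvSpan (planeInvolution hB h) p q where
  left := by rw [planeInvolution_apply, h.map_left hB]
  right := by rw [planeInvolution_apply, h.map_right]
  span := by
    intro x hx
    refine ⟨φ x, ψ x, ?_⟩
    have h2 : B p x • (α • p + β • q) + B q x • (β • p + γ • q) = (2 : ℤ) • x := by
      rw [planeInvolution_apply, planeMap_apply, sub_eq_iff_eq_add] at hx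
      rw [hx, two_smul]
    have e1 := congrArg φ h2
    have e2 := congrArg ψ h2
    simp only [map_add, map_smul, smul_eq_mul, hφp, hφq, hψp, hψq] at e1 e2
    have h3 : (2 : ℤ) • x = (2 : ℤ) • (φ x • p + ψ x • q) := by
      rw [smul_add, smul_smul, smul_smul, ← e1, ← e2, ← h2]
      module
    exact smul_right_injective L two_ne_zero h3

theorem gramInv_U : GramInv LambdaB lamE₁ lamF₁ 0 2 0 := by
  constructor <;> simp [-zsmul_eq_mul, lamE₁_pair, lamF₁_pair] <;> simp [-zsmul_eq_mul, lamE₁, lamF₁]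

theorem gramInv_U2 : GramInv LambdaB lamE₁ ((2 : ℤ) • lamF₁ + lamE₂) 0 1 0 := by
  constructor <;> simp [-zsmul_eq_mul, lamE₁_pair, lamF₁_pair, lamE₂_pair] <;> simp [-zsmul_eq_mul, lamE₁, lamF₁, lamE₂]

theorem gramInv_diag_two : GramInv LambdaB (lamE₁ + lamF₁) lamδ 1 0 (-1) := by
  constructor <;> simp [-zsmul_eq_mul, lamE₁_pair, lamF₁_pair, lamδ_pair] <;> simp [-zsmul_eq_mul, lamE₁, lamF₁, lamδ]

theorem gramInv_diag_one :
    GramInv LambdaB lamE₁ ((2 : ℤ) • lamF₁ + lamE₂ + lamF₂) (-1) 1 0 := by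
  constructor <;> simp [-zsmul_eq_mul, lamE₁_pair, lamF₁_pair, lamE₂_pair, lamF₂_pair] <;>
    simp [-zsmul_eq_mul, lamE₁, lamF₁, lamE₂, lamF₂]

/-- The involution whose invariant lattice is the first hyperbolic plane. -/
def invU : LambdaM ≃ₗ[ℤ] LambdaM := planeInvolution LambdaB_symm gramInv_U

/-- An involution with invariant lattice `U(2)`. -/
def invU2 : LambdaM ≃ₗ[ℤ] LambdaM := planeInvolution LambdaB_symm gramInv_U2

/-- An involution with invariant lattice `⟨2⟩ ⊕ ⟨-2⟩`, the second summand generated by `δ`. -/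
def invDiagTwo : LambdaM ≃ₗ[ℤ] LambdaM := planeInvolution LambdaB_symm gramInv_diag_two

/-- An involution with invariant lattice `⟨2⟩ ⊕ ⟨-2⟩`, the second summand of divisibility one. -/
def invDiagOne : LambdaM ≃ₗ[ℤ] LambdaM := planeInvolution LambdaB_symm gramInv_diag_one

theorem isIsometry_planeInvolution {p q : LambdaM} {α β γ : ℤ} (h : GramInv LambdaB p q α β γ) :
    IsIsometry (planeInvolution LambdaB_symm h) ∧
      ∀ x, planeInvolution LambdaB_symm h (planeInvolution LambdaB_symm h x) = x :=
  ⟨h.isometry LambdaB_symm, h.involutive LambdaB_symm⟩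

theorem invSpan_invU : InvSpan invU lamE₁ lamF₁ := by
  refine gramInv_U.invSpan LambdaB_symm (φ := LambdaB lamF₁) (ψ := LambdaB lamE₁) ?_ ?_ ?_ ?_ <;>
    simp [-zsmul_eq_mul, lamE₁_pair, lamF₁_pair] <;> simp [-zsmul_eq_mul, lamE₁, lamF₁]

theorem invSpan_invU2 : InvSpan invU2 lamE₁ ((2 : ℤ) • lamF₁ + lamE₂) := by
  refine gramInv_U2.invSpan LambdaB_symm (φ := LambdaB lamF₁) (ψ := LambdaB lamF₂) ?_ ?_ ?_ ?_ <;>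
    simp [-zsmul_eq_mul, lamF₁_pair, lamF₂_pair] <;> simp [-zsmul_eq_mul, lamE₁, lamF₁, lamE₂]

theorem invSpan_invDiagTwo : InvSpan invDiagTwo (lamE₁ + lamF₁) lamδ := by
  refine gramInv_diag_two.invSpan LambdaB_symm (φ := LambdaB lamE₁)
    (ψ := LinearMap.proj 0 ∘ₗ LinearMap.snd ℤ _ _ ∘ₗ LinearMap.snd ℤ _ _ ∘ₗ
      LinearMap.snd ℤ _ _ ∘ₗ LinearMap.snd ℤ _ _ ∘ₗ LinearMap.snd ℤ _ _) ?_ ?_ ?_ ?_ <;>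
    simp [-zsmul_eq_mul, lamE₁_pair] <;> simp [-zsmul_eq_mul, lamE₁, lamF₁, lamδ]

theorem invSpan_invDiagOne :
    InvSpan invDiagOne ((2 : ℤ) • lamF₁ + lamE₂ + lamF₂)
      ((2 : ℤ) • lamF₁ + lamE₂ + lamF₂ - lamE₁) := by
  have h : InvSpan invDiagOne lamE₁ ((2 : ℤ) • lamF₁ + lamE₂ + lamF₂) := by
    refine gramInv_diag_one.invSpan LambdaB_symm (φ := LambdaB lamF₁) (ψ := LambdaB lamF₂)
      ?_ ?_ ?_ ?_ <;>
      simp [-zsmul_eq_mul, lamF₁_pair, lamF₂_pair] <;> simp [-zsmul_eq_mul, lamE₁, lamF₁, lamE₂, lamF₂]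
  have := h.change (x := 0) (y := 1) (z := -1) (w := 1) (ε := 1) (by norm_num) (by norm_num)
  convert this using 1 <;> module

/-- `p, q` is a basis of the invariant lattice of `f` with Gram matrix `[[r, s], [s, u]]`. -/
structure InvGram (f : LambdaM ≃ₗ[ℤ] LambdaM) (p q : LambdaM) (r s u : ℤ) : Prop
    extends InvSpan f p q where
  pp : LambdaB p p = r
  pq : LambdaB p q = s
  qq : LambdaB q q = u
  det : r * u - s ^ 2 ≠ 0

theorem invGram_invU : InvGram invU lamE₁ lamF₁ 0 1 0 := by
  refine ⟨invSpan_invU, ?_, ?_, ?_, by norm_num⟩ <;>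
    simp [-zsmul_eq_mul, lamE₁_pair, lamF₁_pair] <;> simp [-zsmul_eq_mul, lamE₁, lamF₁]

theorem invGram_invU2 : InvGram invU2 lamE₁ ((2 : ℤ) • lamF₁ + lamE₂) 0 2 0 := by
  refine ⟨invSpan_invU2, ?_, ?_, ?_, by norm_num⟩ <;>
    simp [-zsmul_eq_mul, lamE₁_pair, lamF₁_pair, lamE₂_pair] <;> simp [-zsmul_eq_mul, lamE₁, lamF₁, lamE₂]

theorem invGram_invDiagTwo : InvGram invDiagTwo (lamE₁ + lamF₁) lamδ 2 0 (-2) := by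
  refine ⟨invSpan_invDiagTwo, ?_, ?_, ?_, by norm_num⟩ <;>
    simp [-zsmul_eq_mul, lamE₁_pair, lamF₁_pair, lamδ_pair] <;> simp [-zsmul_eq_mul, lamE₁, lamF₁, lamδ]

theorem invGram_invDiagOne :
    InvGram invDiagOne ((2 : ℤ) • lamF₁ + lamE₂ + lamF₂)
      ((2 : ℤ) • lamF₁ + lamE₂ + lamF₂ - lamE₁) 2 0 (-2) := by
  refine ⟨invSpan_invDiagOne, ?_, ?_, ?_, by norm_num⟩ <;>
    simp [-zsmul_eq_mul, lamE₁_pair, lamF₁_pair, lamE₂_pair, lamF₂_pair] <;> simp [-zsmul_eq_mul, lamE₁, lamF₁, lamE₂, lamF₂]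

variable {f : LambdaM ≃ₗ[ℤ] LambdaM} {p q : LambdaM} {r s u : ℤ}

theorem InvGram.det_ne_zero (h : InvGram f p q r s u) :
    LambdaB p p * LambdaB q q - LambdaB p q ^ 2 ≠ 0 := by
  rw [h.pp, h.pq, h.qq]; exact h.det

theorem InvGram.form (h : InvGram f p q r s u) (m n m' n' : ℤ) :
    LambdaB (m • p + n • q) (m' • p + n' • q) =
      r * m * m' + s * (m * n' + n * m') + u * n * n' := by
  simp only [map_add, map_smul, LinearMap.add_apply, LinearMap.smul_apply, smul_eq_mul,
    LambdaB_symm q p, h.pp, h.pq, h.qq]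
  ring

theorem InvGram.mem (h : InvGram f p q r s u) (m n : ℤ) : m • p + n • q ∈ invLattice f := by
  simp [-zsmul_eq_mul, invLattice, LinearMap.mem_eqLocus, h.left, h.right]

theorem InvGram.exists_coeff (h : InvGram f p q r s u) {x : LambdaM} (hx : x ∈ invLattice f) :
    ∃ m n : ℤ, x = m • p + n • q := h.span x hx

theorem InvGram.exists_invLattice_equiv (h : InvGram f p q r s u) :
    ∃ e : (Fin 2 → ℤ) ≃ₗ[ℤ] invLattice f, ∀ c, (e c : LambdaM) = c 0 • p + c 1 • q :=
  h.exists_equiv LambdaB_symm h.det_ne_zero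

theorem InvGram.isometricTo (h : InvGram f p q r s u) :
    IsometricTo (invLattice f) (gramBilin !![r, s; s, u]) := by
  obtain ⟨e, he⟩ := h.exists_invLattice_equiv
  refine ⟨e.symm, fun x y => ?_⟩
  obtain ⟨c, rfl⟩ := e.surjective x
  obtain ⟨d, rfl⟩ := e.surjective y
  rw [e.symm_apply_apply, e.symm_apply_apply, he, he, h.form, gramBilin_apply]
  simp [dotProduct, Fin.sum_univ_two, Matrix.mulVec]
  ring

theorem InvGram.sigOneOne (h : InvGram f p q r s u) {m n m' n' : ℤ}
    (hpos : 0 < r * m * m + s * (m * n + n * m) + u * n * n)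
    (hneg : r * m' * m' + s * (m' * n' + n' * m') + u * n' * n' < 0) :
    SigOneOne (invLattice f) := by
  obtain ⟨e, -⟩ := h.exists_invLattice_equiv
  refine ⟨?_, ⟨_, h.mem m n, by rwa [h.form]⟩, ⟨_, h.mem m' n', by rwa [h.form]⟩⟩
  exact e.finrank_eq.symm.trans (by simp)

/-- The elements of square `-2` in `⟨2⟩ ⊕ ⟨-2⟩`. -/
theorem InvGram.eq_or_eq_neg (h : InvGram f p q 2 0 (-2)) {g : LambdaM} (hg : g ∈ invLattice f)
    (hgg : LambdaB g g = -2) : g = q ∨ g = -q := by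
  obtain ⟨m, n, rfl⟩ := h.exists_coeff hg
  rw [h.form] at hgg
  have h1 : (n + m) * (n - m) = 1 := by linarith
  rcases Int.mul_eq_one_iff_eq_one_or_neg_one.mp h1 with ⟨h2, h3⟩ | ⟨h2, h3⟩
  · left
    rw [show m = 0 by omega, show n = 1 by omega]
    simp
  · right
    rw [show m = 0 by omega, show n = -1 by omega]
    simp

theorem HasDivisibility.neg {v : LambdaM} {d : ℤ} (h : HasDivisibility v d) :
    HasDivisibility (-v) d := by
  obtain ⟨h1, h2, x, hx⟩ := h
  exact ⟨h1, fun y => by simpa using h2 y, -x, by simpa using hx⟩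

theorem InvGram.hasDivisibility (h : InvGram f p q 2 0 (-2)) {d : ℤ} (hq : HasDivisibility q d) :
    ∀ g ∈ invLattice f, LambdaB g g = -2 → HasDivisibility g d := by
  intro g hg hgg
  rcases h.eq_or_eq_neg hg hgg with rfl | rfl
  · exact hq
  · exact hq.neg

theorem hasDivisibility_lamδ : HasDivisibility lamδ 2 :=
  ⟨by norm_num, fun x => ⟨-x.2.2.2.2.2 0, by rw [lamδ_pair]; ring⟩, -lamδ, by
    rw [lamδ_pair]; simp [-zsmul_eq_mul, lamδ]⟩

theorem hasDivisibility_diagOne :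
    HasDivisibility ((2 : ℤ) • lamF₁ + lamE₂ + lamF₂ - lamE₁) 1 :=
  ⟨by norm_num, fun x => one_dvd _, lamE₂, by
    simp [-zsmul_eq_mul, lamE₁_pair, lamF₁_pair, lamE₂_pair, lamF₂_pair]; simp [-zsmul_eq_mul, lamE₂]⟩

theorem ConjInO.exists_equiv {ι ι' : LambdaM ≃ₗ[ℤ] LambdaM} (h : ConjInO ι ι') :
    ∃ γ : LambdaM ≃ₗ[ℤ] LambdaM, IsIsometry γ ∧
      (∀ x ∈ invLattice ι, γ x ∈ invLattice ι') ∧ ∀ x ∈ invLattice ι', γ.symm x ∈ invLattice ι := by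
  obtain ⟨γ, hγ, h⟩ := h
  refine ⟨γ, hγ, fun x hx => ?_, fun x hx => ?_⟩
  · change ι x = x at hx
    change ι' (γ x) = γ x
    rw [h, γ.symm_apply_apply, hx]
  · change ι' x = x at hx
    change ι (γ.symm x) = γ.symm x
    rw [γ.eq_symm_apply, ← h, hx]

theorem not_conjInO_invU (h : InvGram f p q r s u) (hr : 2 ∣ r) (hs : 2 ∣ s) (hu : 2 ∣ u) :
    ¬ ConjInO invU f := by
  intro hc
  obtain ⟨γ, hγ, h1, -⟩ := hc.exists_equiv
  obtain ⟨m, n, hm⟩ := h.exists_coeff (h1 _ invSpan_invU.left)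
  obtain ⟨m', n', hm'⟩ := h.exists_coeff (h1 _ invSpan_invU.right)
  have h2 : LambdaB (γ lamE₁) (γ lamF₁) = 1 := by rw [hγ]; exact invGram_invU.pq
  rw [hm, hm', h.form] at h2
  have : (2 : ℤ) ∣ 1 := by
    rw [← h2]
    exact dvd_add (dvd_add ((hr.mul_right _).mul_right _) (hs.mul_right _))
      ((hu.mul_right _).mul_right _)
  norm_num at this

theorem not_conjInO_invU2 (h : InvGram f p q 2 0 (-2)) : ¬ ConjInO invU2 f := by
  intro hc
  obtain ⟨γ, hγ, -, h1⟩ := hc.exists_equiv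
  obtain ⟨m, n, hm⟩ := invGram_invU2.exists_coeff (h1 _ h.left)
  have h2 : LambdaB (γ.symm p) (γ.symm p) = 2 := by
    rw [← hγ, γ.apply_symm_apply]; exact h.pp
  rw [hm, invGram_invU2.form] at h2
  have : 4 * (m * n) = 2 := by linarith
  omega

theorem not_conjInO_invDiagTwo : ¬ ConjInO invDiagTwo invDiagOne := by
  intro hc
  obtain ⟨γ, hγ, h1, -⟩ := hc.exists_equiv
  obtain ⟨-, -, y, hy⟩ := invGram_invDiagOne.hasDivisibility hasDivisibility_diagOne _
    (h1 _ invSpan_invDiagTwo.right) (by rw [hγ]; exact invGram_invDiagTwo.qq)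
  rw [← γ.apply_symm_apply y, hγ, lamδ_pair] at hy
  omega

end Involutions

section NormalForms

theorem lamE₁_lamE₁ : LambdaB lamE₁ lamE₁ = 0 := hypPairs_empty.e₁e₁
theorem lamE₁_lamF₁ : LambdaB lamE₁ lamF₁ = 1 := hypPairs_empty.e₁f₁
theorem lamF₁_lamE₁ : LambdaB lamF₁ lamE₁ = 1 := by rw [LambdaB_symm, lamE₁_lamF₁]
theorem lamF₁_lamF₁ : LambdaB lamF₁ lamF₁ = 0 := hypPairs_empty.f₁f₁
theorem lamδ_lamδ : LambdaB lamδ lamδ = -2 := by rw [lamδ_pair]; simp [lamδ]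
theorem lamδ_lamE₁ : LambdaB lamδ lamE₁ = 0 := by rw [lamδ_pair]; simp [lamE₁]
theorem lamE₁_lamδ : LambdaB lamE₁ lamδ = 0 := by rw [LambdaB_symm, lamδ_lamE₁]
theorem lamδ_lamF₁ : LambdaB lamδ lamF₁ = 0 := by rw [lamδ_pair]; simp [lamF₁]
theorem lamF₁_lamδ : LambdaB lamF₁ lamδ = 0 := by rw [LambdaB_symm, lamδ_lamF₁]

theorem exists_isometry_lamE₁ {a y : LambdaM} (haa : LambdaB a a = 0) (hay : LambdaB a y = 1) :
    ∃ g : LambdaM ≃ₗ[ℤ] LambdaM, FixIso LambdaB ∅ g ∧ g a = lamE₁ := by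
  obtain ⟨g, hg, h⟩ := hypPairs_empty.normal_of_isUnit LambdaB_symm LambdaB_even
    (v := a) (y := y) (by simp [PerpTo]) (by simp [PerpTo]) hay (k := 0) (by simpa using haa)
  exact ⟨g, hg, by simpa using h⟩

theorem exists_isometry_U {a b : LambdaM} (haa : LambdaB a a = 0) (hab : LambdaB a b = 1)
    (hbb : LambdaB b b = 0) :
    ∃ g : LambdaM ≃ₗ[ℤ] LambdaM, IsIsometry g ∧ g a = lamE₁ ∧ g b = lamF₁ := by
  obtain ⟨g, hg, hga⟩ := exists_isometry_lamE₁ haa hab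
  have h1 : LambdaB lamE₁ (g b) = 1 := by rw [← hga, hg.1, hab]
  have h2 : LambdaB (g b) (g b) = 0 := by rw [hg.1, hbb]
  obtain ⟨n, hn⟩ : ∃ n, n = g b - lamF₁ - LambdaB lamF₁ (g b) • lamE₁ := ⟨_, rfl⟩
  have hE : LambdaB lamE₁ n = 0 := by
    rw [hn]; simp [-zsmul_eq_mul, h1, lamE₁_lamF₁, lamE₁_lamE₁]
  have hF : LambdaB lamF₁ n = 0 := by
    rw [hn]; simp [-zsmul_eq_mul, lamF₁_lamF₁, lamF₁_lamE₁]
  have hgb : g b = n + lamF₁ + LambdaB lamF₁ (g b) • lamE₁ := by rw [hn]; abel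
  obtain ⟨c, hc⟩ : ∃ c, c = LambdaB lamF₁ (g b) := ⟨_, rfl⟩
  rw [← hc] at hgb
  obtain ⟨q, hq⟩ := LambdaB_even n
  have hcq : c = -q := by
    rw [hgb] at h2
    simp only [map_add, map_smul, LinearMap.add_apply, LinearMap.smul_apply, smul_eq_mul,
      LambdaB_symm n lamE₁, LambdaB_symm n lamF₁, hE, hF, lamE₁_lamF₁, lamF₁_lamE₁, lamE₁_lamE₁,
      lamF₁_lamF₁, hq] at h2
    omega
  obtain ⟨t, ht, htb⟩ := eichler_mem_fixOrbit LambdaB_symm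
    (self_mem_fixOrbit (B := LambdaB) {lamE₁} (g b)) (e := lamE₁) (w := -n) q
    (by simp [PerpTo, lamE₁_lamE₁]) (by simp [PerpTo, LambdaB_symm n, hE]) lamE₁_lamE₁
    (by simp [hE]) (by simpa using hq)
  refine ⟨g.trans t, (hg.trans (ht.mono (by simp))).1, ?_, ?_⟩
  · rw [LinearEquiv.trans_apply, hga, ht.2 _ rfl]
  · rw [LinearEquiv.trans_apply, htb, h1]
    have hnb : LambdaB n (g b) = 2 * q := by
      rw [hgb]
      simp [-zsmul_eq_mul, LambdaB_symm n lamE₁, LambdaB_symm n lamF₁, hE, hF, hq]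
    rw [map_neg, LinearMap.neg_apply, hnb, hgb, hcq]
    module

theorem exists_isometry_two {a b y z : LambdaM} {k : ℤ} (haa : LambdaB a a = 0)
    (hab : LambdaB a b = 2) (hbb : LambdaB b b = 2 * k) (hay : LambdaB a y = 1)
    (haz : LambdaB a z = 0) (hbz : LambdaB b z = 1) :
    ∃ g : LambdaM ≃ₗ[ℤ] LambdaM, IsIsometry g ∧ g a = lamE₁ ∧
      g b = (2 : ℤ) • lamF₁ + (lamE₂ + k • lamF₂) := by
  obtain ⟨g, hg, hga⟩ := exists_isometry_lamE₁ haa hay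
  have h1 : LambdaB lamE₁ (g b) = 2 := by rw [← hga, hg.1, hab]
  have h2 : LambdaB (g b) (g b) = 2 * k := by rw [hg.1, hbb]
  have h3 : LambdaB lamE₁ (g z) = 0 := by rw [← hga, hg.1, haz]
  have h4 : LambdaB (g b) (g z) = 1 := by rw [hg.1, hbz]
  obtain ⟨c, hc⟩ : ∃ c, c = LambdaB lamF₁ (g b) := ⟨_, rfl⟩
  obtain ⟨j, hj⟩ : ∃ j, j = LambdaB lamF₁ (g z) := ⟨_, rfl⟩
  obtain ⟨n, hn⟩ : ∃ n, n = g b - (2 : ℤ) • lamF₁ - c • lamE₁ := ⟨_, rfl⟩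
  have hgb : g b = n + (2 : ℤ) • lamF₁ + c • lamE₁ := by rw [hn]; abel
  have hEn : LambdaB lamE₁ n = 0 := by
    rw [hn]; simp [-zsmul_eq_mul, h1, lamE₁_lamF₁, lamE₁_lamE₁]
  have hFn : LambdaB lamF₁ n = 0 := by
    rw [hn]; simp [-zsmul_eq_mul, lamF₁_lamF₁, lamF₁_lamE₁, hc]
  obtain ⟨x, ⟨g₁, hg₁, hx⟩, hdvd⟩ := hypPairs_plane.exists_dvd LambdaB_symm LambdaB_even n
  have hnS : PerpTo LambdaB {lamE₁, lamF₁} n := by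
    simp [PerpTo, LambdaB_symm n, hEn, hFn]
  have hxS : PerpTo LambdaB {lamE₁, lamF₁} x := hx ▸ hg₁.perpTo hnS
  have hE₁x : LambdaB lamE₁ x = 0 := by rw [LambdaB_symm]; exact hxS _ (by simp)
  have hF₁x : LambdaB lamF₁ x = 0 := by rw [LambdaB_symm]; exact hxS _ (by simp)
  -- the coefficient of `lamE₂` in `x` is odd
  obtain ⟨t, ht⟩ : ∃ t, LambdaB lamF₂ x + 2 * t = 1 := by
    have hzS : PerpTo LambdaB {lamE₁, lamF₁} (g z - j • lamE₁) := by
      simp [-zsmul_eq_mul, PerpTo, LambdaB_symm (g z), h3, lamE₁_lamE₁, lamE₁_lamF₁, hj]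
    have h5 := hdvd _ (hg₁.perpTo hzS)
    have h6 : LambdaB n (g z - j • lamE₁) = 1 - 2 * j := by
      rw [hn]
      simp only [map_sub, map_smul, LinearMap.sub_apply, LinearMap.smul_apply, smul_eq_mul, h4,
        LambdaB_symm (g b) lamE₁, h1, h3, ← hj, lamF₁_lamE₁, lamE₁_lamE₁]
      ring
    rw [← hx, hg₁.1, h6, hx] at h5
    obtain ⟨d, hd⟩ := h5
    have hodd : Odd (LambdaB lamF₂ x) :=
      (Int.odd_mul.mp (hd ▸ ⟨-j, by ring⟩ : Odd (LambdaB lamF₂ x * d))).1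
    obtain ⟨i, hi⟩ := hodd
    exact ⟨-i, by omega⟩
  have hb₁ : x + (2 : ℤ) • lamF₁ + c • lamE₁ ∈ FixOrbit LambdaB {lamE₁} (g b) := by
    refine ⟨g₁, hg₁.mono (by simp), ?_⟩
    rw [hgb, map_add, map_add, map_smul, map_smul, hx, hg₁.2 lamE₁ (by simp),
      hg₁.2 lamF₁ (by simp)]
  obtain ⟨s, hs⟩ : ∃ s, s = c - t * LambdaB lamE₂ x := ⟨_, rfl⟩
  have h := hypPairs_plane
  have hE₂E₁ : LambdaB lamE₂ lamE₁ = 0 := h.e₁S _ (by simp)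
  have hE₂F₁ : LambdaB lamE₂ lamF₁ = 0 := h.e₁S _ (by simp)
  have hF₂E₁ : LambdaB lamF₂ lamE₁ = 0 := h.f₁S _ (by simp)
  have hF₂F₁ : LambdaB lamF₂ lamF₁ = 0 := h.f₁S _ (by simp)
  have hE₁E₂ : LambdaB lamE₁ lamE₂ = 0 := by rw [LambdaB_symm, hE₂E₁]
  have hE₁F₂ : LambdaB lamE₁ lamF₂ = 0 := by rw [LambdaB_symm, hF₂E₁]
  have hF₂E₂ : LambdaB lamF₂ lamE₂ = 1 := by rw [LambdaB_symm, h.e₁f₁]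
  have hb₂ := eichler_mem_fixOrbit LambdaB_symm hb₁ (e := lamE₁) (w := t • lamE₂ + s • lamF₂)
    (t * s) (by simp [PerpTo, lamE₁_lamE₁])
    (by simp [-zsmul_eq_mul, PerpTo, hE₂E₁, hF₂E₁]) lamE₁_lamE₁
    (by simp [-zsmul_eq_mul, hE₁E₂, hE₁F₂])
    (by simp [-zsmul_eq_mul, h.e₁e₁, h.e₁f₁, hF₂E₂, h.f₁f₁]; ring)
  obtain ⟨x₂, hx₂⟩ : ∃ x₂, x₂ = x + (2 : ℤ) • (t • lamE₂ + s • lamF₂) := ⟨_, rfl⟩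
  have hb₃ : x₂ + (2 : ℤ) • lamF₁ ∈ FixOrbit LambdaB {lamE₁} (g b) := by
    convert hb₂ using 1
    simp only [map_add, map_smul, LinearMap.add_apply, LinearMap.smul_apply, smul_eq_mul, hE₁x,
      lamE₁_lamF₁, lamE₁_lamE₁, hE₂F₁, hF₂F₁, hE₂E₁, hF₂E₁, hx₂]
    have e1 : c = t * LambdaB lamE₂ x + s * LambdaB lamF₂ x + 2 * (t * s) := by
      linear_combination -s * ht - hs
    have e2 : c • lamE₁ =
        (t * LambdaB lamE₂ x + s * LambdaB lamF₂ x + 2 * (t * s)) • lamE₁ := by rw [← e1]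
    rw [e2]
    module
  have hx₂S : PerpTo LambdaB {lamE₁, lamF₁} x₂ := by
    rw [hx₂]
    exact perpTo_add hxS (perpTo_smul _ (perpTo_add (perpTo_smul _ h.e₁S) (perpTo_smul _ h.f₁S)))
  have hF₁x₂ : LambdaB x₂ lamF₁ = 0 := hx₂S _ (by simp)
  have hx₂x₂ : LambdaB x₂ x₂ = 2 * k := by
    rw [← h2, ← fixOrbit_form hb₃]
    simp [-zsmul_eq_mul, LambdaB_symm lamF₁ x₂, hF₁x₂, lamF₁_lamF₁]
  have hF₂x₂ : LambdaB lamF₂ x₂ = 1 := by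
    rw [hx₂]
    simp only [map_add, map_smul, smul_eq_mul, hF₂E₂, h.f₁f₁]
    linarith
  obtain ⟨g₃, hg₃, hgx⟩ := h.normal_of_value_one LambdaB_symm LambdaB_even hx₂S hF₂x₂ hx₂x₂
  obtain ⟨g₂, hg₂, hgb₂⟩ := hb₃
  refine ⟨(g.trans g₂).trans g₃, ((hg.trans (hg₂.mono (by simp))).trans (hg₃.mono (by simp))).1,
    ?_, ?_⟩
  · simp only [LinearEquiv.trans_apply]
    rw [hga, hg₂.2 _ rfl, hg₃.2 _ (by simp)]
  · simp only [LinearEquiv.trans_apply]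
    rw [hgb₂, map_add, map_smul, hgx, hg₃.2 _ (by simp), add_comm]

theorem odd_of_form {z : LambdaM} {k : ℤ} (hz : LambdaB lamδ z = 0)
    (h : ∃ j, LambdaB ((2 : ℤ) • z + k • lamδ) ((2 : ℤ) • z + k • lamδ) = -2 + 8 * j) : Odd k := by
  obtain ⟨j, h⟩ := h
  obtain ⟨q, hq⟩ := LambdaB_even z
  simp only [map_add, map_smul, LinearMap.add_apply, LinearMap.smul_apply, smul_eq_mul,
    LambdaB_symm z lamδ, hz, hq, lamδ_lamδ] at h
  rw [← Int.not_even_iff_odd]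
  rintro ⟨i, rfl⟩
  have : 4 * (2 * q - 2 * (i * i) - 2 * j) = -2 := by linear_combination h
  omega

theorem lamδ_mem_fixOrbit {v : LambdaM} (hv : ∀ y, 2 ∣ LambdaB v y) (hvv : LambdaB v v = -2) :
    lamδ ∈ FixOrbit LambdaB ∅ v := by
  obtain ⟨x, hx, hdvd⟩ := hypPairs_empty.exists_dvd LambdaB_symm LambdaB_even v
  have hxx : LambdaB x x = -2 := by rw [fixOrbit_form hx, hvv]
  have hx2 : ∀ y, 2 ∣ LambdaB x y := by
    obtain ⟨g, hg, rfl⟩ := hx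
    intro y
    rw [← g.apply_symm_apply y, hg.1]
    exact hv _
  obtain ⟨ε, hε⟩ : 2 ∣ LambdaB lamF₁ x := by rw [LambdaB_symm]; exact hx2 _
  have hεε : ε * ε = 1 := by
    have h1 := hdvd x (by simp [PerpTo])
    rw [hε, hxx] at h1
    obtain ⟨d, hd⟩ := h1
    have h2 : ε * (-d) = 1 := by linarith
    rcases Int.mul_eq_one_iff_eq_one_or_neg_one.mp h2 with ⟨rfl, -⟩ | ⟨rfl, -⟩ <;> norm_num
  obtain ⟨z, k, hxz, hδz⟩ := eq_of_forall_even hx2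
  obtain ⟨κ, hκ⟩ : Odd k := odd_of_form hδz ⟨0, by rw [← hxz, hxx]; norm_num⟩
  have hFz : LambdaB lamF₁ z = ε := by
    have : 2 * LambdaB lamF₁ z = 2 * ε := by
      rw [← hε, hxz]; simp [-zsmul_eq_mul, lamF₁_lamδ]
    omega
  obtain ⟨w, hw⟩ : ∃ w, w = -ε • (z - ε • lamE₁ - LambdaB lamE₁ z • lamF₁ + κ • lamδ) := ⟨_, rfl⟩
  obtain ⟨q, hq⟩ := LambdaB_even w
  have hFw : LambdaB lamF₁ w = 0 := by
    rw [hw]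
    simp [-zsmul_eq_mul, hFz, lamF₁_lamE₁, lamF₁_lamF₁, lamF₁_lamδ]
  have h1 := eichler_mem_fixOrbit LambdaB_symm hx q (by simp [PerpTo]) (by simp [PerpTo])
    lamF₁_lamF₁ hFw hq
  obtain ⟨c, hc⟩ : ∃ c, c = 2 * LambdaB lamE₁ z - LambdaB w x - q * (2 * ε) := ⟨_, rfl⟩
  have h2 : x + LambdaB lamF₁ x • w - LambdaB w x • lamF₁ - (q * LambdaB lamF₁ x) • lamF₁ =
      (2 * ε) • lamE₁ + lamδ + c • lamF₁ := by
    have e1 : (2 * ε) • w =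
        -((2 : ℤ) • (z - ε • lamE₁ - LambdaB lamE₁ z • lamF₁ + κ • lamδ)) := by
      rw [hw, smul_smul, show 2 * ε * -ε = -2 by linarith, neg_smul]
    rw [hε, e1, hc]
    nth_rewrite 1 [hxz]
    rw [hκ]
    module
  rw [h2] at h1
  have hc0 : c = 0 := by
    have h3 := (fixOrbit_form h1).trans hvv
    simp only [map_add, map_smul, LinearMap.add_apply, LinearMap.smul_apply, smul_eq_mul,
      lamE₁_lamE₁, lamE₁_lamF₁, lamF₁_lamE₁, lamF₁_lamF₁, lamδ_lamδ, lamδ_lamE₁, lamE₁_lamδ,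
      lamδ_lamF₁, lamF₁_lamδ] at h3
    linear_combination -c * hεε + ε * (by linarith : c * ε = 0)
  rw [hc0, zero_smul, add_zero] at h1
  have h3 := eichler_mem_fixOrbit LambdaB_symm h1 (e := lamE₁) (w := -ε • lamδ) (-(ε * ε))
    (by simp [PerpTo]) (by simp [PerpTo]) lamE₁_lamE₁ (by simp [-zsmul_eq_mul, lamE₁_lamδ])
    (by simp [-zsmul_eq_mul, lamδ_lamδ]; ring)
  convert h3 using 1
  simp only [map_add, map_smul, LinearMap.smul_apply, smul_eq_mul,
    lamE₁_lamE₁, lamδ_lamδ, lamδ_lamE₁, lamE₁_lamδ]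
  module

theorem exists_isometry_diag {e g y : LambdaM} (hg : ∀ y, 2 ∣ LambdaB g y)
    (hgg : LambdaB g g = -2) (hee : LambdaB e e = 2) (heg : LambdaB e g = 0)
    (hey : LambdaB e y = 1) (hyg : LambdaB y g = 0) :
    ∃ γ : LambdaM ≃ₗ[ℤ] LambdaM, IsIsometry γ ∧ γ e = lamE₁ + lamF₁ ∧ γ g = lamδ := by
  obtain ⟨γ, hγ, hδ⟩ := lamδ_mem_fixOrbit hg hgg
  obtain ⟨η, hη, he⟩ := hypPairs_δ.normal_of_isUnit LambdaB_symm LambdaB_even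
    (v := γ e) (y := γ y) (by simp [PerpTo, ← hδ, hγ.1, heg]) (by simp [PerpTo, ← hδ, hγ.1, hyg])
    (by rw [hγ.1, hey]) (k := 1) (by rw [hγ.1, hee]; norm_num)
  refine ⟨γ.trans η, (hγ.trans (hη.mono (by simp))).1, ?_, ?_⟩
  · simpa using he
  · rw [LinearEquiv.trans_apply, hδ, hη.2 _ rfl]

end NormalForms

section Classification

variable {f : LambdaM ≃ₗ[ℤ] LambdaM} {p q : LambdaM} {r s u : ℤ}

theorem conjInO_planeInvolution {p' q' : LambdaM} {α β γ : ℤ} (h : GramInv LambdaB p' q' α β γ)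
    (hf : IsIsometry f) (hff : ∀ x, f (f x) = x) (hs : InvSpan f p q)
    (hg : ∃ g : LambdaM ≃ₗ[ℤ] LambdaM, IsIsometry g ∧ g p = p' ∧ g q = q') :
    ConjInO f (planeInvolution LambdaB_symm h) := by
  obtain ⟨g, hg, hp, hq⟩ := hg
  exact ⟨g, hg, planeInvolution_conj LambdaB_symm h hf hff hs hg hp hq⟩

theorem InvGram.swap (h : InvGram f p q r s u) : InvGram f q p u s r where
  left := h.right
  right := h.left
  span x hx := by
    obtain ⟨m, n, rfl⟩ := h.span x hx
    exact ⟨n, m, add_comm _ _⟩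
  pp := h.qq
  pq := by rw [LambdaB_symm, h.pq]
  qq := h.pp
  det := by rw [mul_comm]; exact h.det

theorem InvGram.change (h : InvGram f p q r s u) {x y z w ε r' s' u' : ℤ} (hε : ε * ε = 1)
    (hdet : x * w - y * z = ε) (hr : r * x * x + s * (x * y + y * x) + u * y * y = r')
    (hs : r * x * z + s * (x * w + y * z) + u * y * w = s')
    (hu : r * z * z + s * (z * w + w * z) + u * w * w = u') :
    InvGram f (x • p + y • q) (z • p + w • q) r' s' u' where
  toInvSpan := h.toInvSpan.change hε hdet
  pp := by rw [h.form, hr]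
  pq := by rw [h.form, hs]
  qq := by rw [h.form, hu]
  det := by
    have : r' * u' - s' ^ 2 = r * u - s ^ 2 := by
      rw [← hr, ← hs, ← hu]
      have h1 : (x * w - y * z) * (x * w - y * z) = 1 := by rw [hdet, hε]
      linear_combination (r * u - s ^ 2) * h1
    rw [this]
    exact h.det

theorem InvGram.exists_reduced (h : InvGram f p q (2 * r) s (2 * u)) {m : ℤ} (hm : 0 < m)
    (hD : s ^ 2 - 4 * r * u = m ^ 2) :
    ∃ a b k, InvGram f a b 0 m (2 * k) ∧ 0 ≤ k ∧ k < m := by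
  obtain ⟨x, y, z, w, ε, k, hε, hdet, h1, h2, h3, hk, hkm⟩ := binary_form_reduction hm hD
  refine ⟨x • p + y • q, z • p + w • q, k, h.change hε hdet ?_ ?_ ?_, hk, hkm⟩
  · linear_combination 2 * h1
  · linear_combination h2
  · linear_combination 2 * h3

theorem InvGram.coeff_eq (h : InvGram f p q r s u) {m n m' n' : ℤ}
    (he : m • p + n • q = m' • p + n' • q) : m = m' ∧ n = n' := by
  have := coeff_eq_zero (p := p) (q := q) LambdaB_symm h.det_ne_zero (m := m - m') (n := n - n')
    (by rw [sub_smul, sub_smul, sub_add_sub_comm, he, sub_self])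
  omega

/-- The coordinates of `f y + y` in terms of the values of `y` on a basis of the invariant
lattice. -/
theorem InvGram.exists_trace (h : InvGram f p q r s u) (hf : IsIsometry f)
    (hff : ∀ x, f (f x) = x) (y : LambdaM) :
    ∃ m n, m * r + n * s = 2 * LambdaB p y ∧ m * s + n * u = 2 * LambdaB q y := by
  obtain ⟨m, n, hmn⟩ := h.span (f y + y) (by rw [map_add, hff, add_comm])
  have key {v : LambdaM} (hv : f v = v) : LambdaB v (m • p + n • q) = 2 * LambdaB v y := by
    rw [← hmn, map_add]
    nth_rewrite 1 [← hv]
    rw [hf]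
    ring
  refine ⟨m, n, ?_, ?_⟩
  · rw [← key h.left]
    simp [-zsmul_eq_mul, h.pp, h.pq]
  · rw [← key h.right]
    simp [-zsmul_eq_mul, LambdaB_symm q p, h.pq, h.qq]

theorem exists_odd_even_value (hp : ∃ y, ¬ 2 ∣ LambdaB p y) (hpq : ∃ y, ¬ 2 ∣ LambdaB (p + q) y) :
    ∃ y, ¬ 2 ∣ LambdaB p y ∧ 2 ∣ LambdaB q y := by
  obtain ⟨y, hy⟩ := hp
  obtain ⟨z, hz⟩ := hpq
  rw [map_add, LinearMap.add_apply] at hz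
  by_cases h1 : 2 ∣ LambdaB q y
  · exact ⟨y, hy, h1⟩
  by_cases h2 : 2 ∣ LambdaB q z
  · exact ⟨z, by omega, h2⟩
  · exact ⟨y - z, by rw [map_sub]; omega, by rw [map_sub]; omega⟩

/-- Dual vectors in `Λ` to a basis of the invariant lattice, provided no primitive invariant
vector has even divisibility. -/
theorem InvGram.exists_dual_vectors (h : InvGram f p q r s u)
    (H : ∀ t, f t = t → (∀ y, 2 ∣ LambdaB t y) → ∃ t', f t' = t' ∧ t = (2 : ℤ) • t') :
    ∃ y z, LambdaB p y = 1 ∧ LambdaB q y = 0 ∧ LambdaB p z = 0 ∧ LambdaB q z = 1 := by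
  have hodd (m n : ℤ) (hmn : ¬ 2 ∣ m ∨ ¬ 2 ∣ n) : ∃ y, ¬ 2 ∣ LambdaB (m • p + n • q) y := by
    by_contra! hc
    obtain ⟨t, ht, htt⟩ := H _ (h.mem m n) hc
    obtain ⟨m', n', rfl⟩ := h.span t ht
    rw [smul_add, smul_smul, smul_smul] at htt
    obtain ⟨h1, h2⟩ := h.coeff_eq htt
    omega
  have hp : ∃ y, ¬ 2 ∣ LambdaB p y := by simpa using hodd 1 0 (by norm_num)
  have hq : ∃ y, ¬ 2 ∣ LambdaB q y := by simpa using hodd 0 1 (by norm_num)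
  have hpq : ∃ y, ¬ 2 ∣ LambdaB (p + q) y := by
    simpa only [one_smul] using hodd 1 1 (by norm_num)
  obtain ⟨y, hpy, hqy⟩ := exists_odd_even_value hp hpq
  obtain ⟨z, hqz, hpz⟩ := exists_odd_even_value hq (add_comm p q ▸ hpq)
  obtain ⟨φ, ψ, h1, h2, h3, h4⟩ := h.exists_dual LambdaB_symm h.det_ne_zero
  obtain ⟨Y, hY⟩ := LambdaB_represents ((2 : ℤ) • φ) (by simp)
  obtain ⟨Z, hZ⟩ := LambdaB_represents ((2 : ℤ) • ψ) (by simp)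
  have hpY : LambdaB p Y = 2 := by rw [LambdaB_symm, hY]; simp [h1]
  have hqY : LambdaB q Y = 0 := by rw [LambdaB_symm, hY]; simp [h2]
  have hpZ : LambdaB p Z = 0 := by rw [LambdaB_symm, hZ]; simp [h3]
  have hqZ : LambdaB q Z = 2 := by rw [LambdaB_symm, hZ]; simp [h4]
  obtain ⟨i, hi⟩ : ∃ i, LambdaB p y = 2 * i + 1 := ⟨LambdaB p y / 2, by omega⟩
  obtain ⟨j, hj⟩ := hqy
  obtain ⟨k, hk⟩ := hpz
  obtain ⟨l, hl⟩ : ∃ l, LambdaB q z = 2 * l + 1 := ⟨LambdaB q z / 2, by omega⟩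
  refine ⟨y - i • Y - j • Z, z - k • Y - l • Z, ?_, ?_, ?_, ?_⟩ <;>
    simp only [map_sub, map_smul, smul_eq_mul, hpY, hqY, hpZ, hqZ, hi, hj, hk, hl] <;> ring

theorem disc_pos_of_indefinite {m n m' n' : ℤ}
    (hpos : 0 < r * m * m + s * (m * n + n * m) + u * n * n)
    (hneg : r * m' * m' + s * (m' * n' + n' * m') + u * n' * n' < 0) : 0 < s ^ 2 - r * u := by
  by_contra! hD
  have key (i j : ℤ) : 0 ≤ r * (r * i * i + s * (i * j + j * i) + u * j * j) := by
    nlinarith [sq_nonneg (r * i + s * j), mul_nonneg (sub_nonneg.mpr hD) (sq_nonneg j)]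
  rcases lt_trichotomy r 0 with hr | rfl | hr
  · exact absurd (key m n) (not_le.mpr (mul_neg_of_neg_of_pos hr hpos))
  · obtain rfl : s = 0 := by nlinarith [sq_nonneg s]
    rcases le_total u 0 with hu | hu
    · nlinarith [mul_self_nonneg n]
    · nlinarith [mul_self_nonneg n']
  · exact absurd (key m' n') (not_le.mpr (mul_neg_of_pos_of_neg hr hneg))

theorem InvGram.disc_pos (h : InvGram f p q r s u) (hsig : SigOneOne (invLattice f)) :
    0 < s ^ 2 - r * u := by
  obtain ⟨-, ⟨x, hx, hxx⟩, y, hy, hyy⟩ := hsig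
  obtain ⟨m, n, rfl⟩ := h.exists_coeff hx
  obtain ⟨m', n', rfl⟩ := h.exists_coeff hy
  rw [h.form] at hxx hyy
  exact disc_pos_of_indefinite hxx hyy

theorem exists_invGram (hsig : SigOneOne (invLattice f)) :
    ∃ p q r s u, InvGram f p q (2 * r) s (2 * u) := by
  obtain ⟨hrank, ⟨x, hx, hxx⟩, y, hy, hyy⟩ := hsig
  obtain ⟨b⟩ : Nonempty (Module.Basis (Fin 2) ℤ (invLattice f)) :=
    ⟨Module.finBasisOfFinrankEq ℤ _ hrank⟩
  have hspan (v : LambdaM) (hv : v ∈ invLattice f) :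
      ∃ m n : ℤ, v = m • (b 0 : LambdaM) + n • (b 1 : LambdaM) := by
    refine ⟨b.repr ⟨v, hv⟩ 0, b.repr ⟨v, hv⟩ 1, ?_⟩
    have := congrArg Subtype.val (b.sum_repr ⟨v, hv⟩)
    rw [Fin.sum_univ_two] at this
    exact this.symm
  obtain ⟨r, hr⟩ := LambdaB_even (b 0 : LambdaM)
  obtain ⟨u, hu⟩ := LambdaB_even (b 1 : LambdaM)
  refine ⟨b 0, b 1, r, LambdaB (b 0 : LambdaM) (b 1 : LambdaM), u,
    ⟨(b 0).2, (b 1).2, hspan⟩, hr, rfl, hu, ?_⟩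
  have form (m n : ℤ) : LambdaB (m • (b 0 : LambdaM) + n • (b 1 : LambdaM))
      (m • (b 0 : LambdaM) + n • (b 1 : LambdaM)) = 2 * r * m * m +
        LambdaB (b 0 : LambdaM) (b 1 : LambdaM) * (m * n + n * m) + 2 * u * n * n := by
    simp only [map_add, map_smul, LinearMap.add_apply, LinearMap.smul_apply, smul_eq_mul,
      LambdaB_symm (b 1 : LambdaM) (b 0 : LambdaM), hr, hu]
    ring
  obtain ⟨m, n, rfl⟩ := hspan x hx
  obtain ⟨m', n', rfl⟩ := hspan y hy
  rw [form] at hxx hyy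
  have := disc_pos_of_indefinite hxx hyy
  omega

theorem conjInO_of_no_even (hf : IsIsometry f) (hff : ∀ x, f (f x) = x)
    (hsig : SigOneOne (invLattice f))
    (H : ∀ t, f t = t → (∀ y, 2 ∣ LambdaB t y) → ∃ t', f t' = t' ∧ t = (2 : ℤ) • t') :
    ConjInO f invU ∨ ConjInO f invU2 ∨ ConjInO f invDiagOne := by
  obtain ⟨p, q, r, s, u, h⟩ := exists_invGram hsig
  have hpos := h.disc_pos hsig
  obtain ⟨y, z, hpy, hqy, hpz, hqz⟩ := h.exists_dual_vectors H
  obtain ⟨m, n, e1, e2⟩ := h.exists_trace hf hff y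
  obtain ⟨m', n', e3, e4⟩ := h.exists_trace hf hff z
  rw [hpy] at e1
  rw [hqy] at e2
  rw [hpz] at e3
  rw [hqz] at e4
  obtain ⟨D, hD⟩ : ∃ D, D = s ^ 2 - 2 * r * (2 * u) := ⟨_, rfl⟩
  rw [← hD] at hpos
  have hdvd : D ∣ 4 := ⟨m' * n - m * n', by
    rw [hD]
    linear_combination -(m' * s + n' * (2 * u)) * e1 + (m' * (2 * r) + n' * s) * e2 - 2 * e4⟩
  have hle : D ≤ 4 := Int.le_of_dvd (by norm_num) hdvd
  have hmod : D = s ^ 2 - 4 * (r * u) := by rw [hD]; ring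
  have hs4 : s ^ 2 % 4 = 0 ∨ s ^ 2 % 4 = 1 := by
    rcases Int.even_or_odd' s with ⟨i, rfl | rfl⟩
    · left; ring_nf; omega
    · right; ring_nf; omega
  have hcases : D = 1 ∨ D = 4 := by omega
  rcases hcases with hD1 | hD4
  · obtain ⟨a, b, k, hab, hk0, hk1⟩ := h.exists_reduced (m := 1) one_pos (by linarith)
    obtain rfl : k = 0 := by omega
    exact Or.inl (conjInO_planeInvolution gramInv_U hf hff hab.toInvSpan
      (exists_isometry_U hab.pp hab.pq (by simpa using hab.qq)))
  · obtain ⟨a, b, k, hab, hk0, hk1⟩ := h.exists_reduced (m := 2) two_pos (by linarith)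
    obtain ⟨y, z, hay, -, haz, hbz⟩ := hab.exists_dual_vectors H
    have hg := exists_isometry_two hab.pp hab.pq hab.qq hay haz hbz
    obtain rfl | rfl : k = 0 ∨ k = 1 := by omega
    · rw [zero_smul, add_zero] at hg
      exact Or.inr (Or.inl (conjInO_planeInvolution gramInv_U2 hf hff hab.toInvSpan hg))
    · rw [one_smul, ← add_assoc] at hg
      exact Or.inr (Or.inr (conjInO_planeInvolution gramInv_diag_one hf hff hab.toInvSpan hg))

/-- A primitive invariant vector all of whose values are even is congruent to `δ` modulo `2Λ`. -/
theorem InvGram.exists_eq_of_even (h : InvGram f p q r s u) (hp : ∀ y, 2 ∣ LambdaB p y) :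
    ∃ (z : LambdaM) (k : ℤ), p = (2 : ℤ) • z + k • lamδ ∧ LambdaB lamδ z = 0 ∧ Odd k := by
  obtain ⟨z, k, hz, hδ⟩ := eq_of_forall_even hp
  refine ⟨z, k, hz, hδ, ?_⟩
  rw [← Int.not_even_iff_odd]
  rintro ⟨i, rfl⟩
  have h1 : p = (2 : ℤ) • (z + i • lamδ) := by rw [hz]; module
  have h2 : f (z + i • lamδ) = z + i • lamδ := by
    apply smul_right_injective LambdaM (two_ne_zero (α := ℤ))
    change (2 : ℤ) • f (z + i • lamδ) = (2 : ℤ) • (z + i • lamδ)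
    rw [← map_smul, ← h1, h.left]
  obtain ⟨m, n, hmn⟩ := h.span _ h2
  have h3 : (1 : ℤ) • p + (0 : ℤ) • q = (2 * m) • p + (2 * n) • q := by
    rw [one_smul, zero_smul, add_zero]
    nth_rewrite 1 [h1]
    rw [hmn, smul_add, smul_smul, smul_smul]
  have := (h.coeff_eq h3).1
  omega

theorem InvGram.exists_dual_vectors_of_even (h : InvGram f p q r s u)
    (hp : ∀ y, 2 ∣ LambdaB p y) :
    ∃ y z, LambdaB p y = 2 ∧ LambdaB q y = 0 ∧ LambdaB p z = 0 ∧ LambdaB q z = 1 := by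
  obtain ⟨φ, ψ, h1, h2, h3, h4⟩ := h.exists_dual LambdaB_symm h.det_ne_zero
  obtain ⟨v, k, hv, -, hk⟩ := h.exists_eq_of_even hp
  have hψ : 2 ∣ ψ lamδ := by
    have e := congrArg ψ hv
    rw [h3, map_add, map_smul, map_smul, smul_eq_mul, smul_eq_mul] at e
    have e' : Even (k * ψ lamδ) := ⟨-ψ v, by linarith⟩
    rcases Int.even_mul.mp e' with h5 | h5
    · exact absurd h5 (Int.not_even_iff_odd.mpr hk)
    · exact h5.two_dvd
  obtain ⟨Y, hY⟩ := LambdaB_represents ((2 : ℤ) • φ) (by simp)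
  obtain ⟨Z, hZ⟩ := LambdaB_represents ψ hψ
  refine ⟨Y, Z, ?_, ?_, ?_, ?_⟩ <;> rw [LambdaB_symm]
  · rw [hY]; simp [h1]
  · rw [hY]; simp [h2]
  · rw [hZ, h3]
  · rw [hZ, h4]

theorem InvGram.form_of_even (h : InvGram f p q r s u) (hp : ∀ y, 2 ∣ LambdaB p y) :
    ∃ j, r = -2 + 8 * j := by
  obtain ⟨z, k, hz, hδ, i, rfl⟩ := h.exists_eq_of_even hp
  obtain ⟨c, hc⟩ := LambdaB_even z
  have h1 := h.pp
  rw [hz] at h1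
  simp only [map_add, map_smul, LinearMap.add_apply, LinearMap.smul_apply, smul_eq_mul,
    LambdaB_symm z lamδ, hδ, hc, lamδ_lamδ] at h1
  exact ⟨c - i ^ 2 - i, by linear_combination -h1⟩

theorem conjInO_of_even (hf : IsIsometry f) (hff : ∀ x, f (f x) = x)
    (hsig : SigOneOne (invLattice f)) (h : InvGram f p q (2 * r) s (2 * u))
    (hp : ∀ y, 2 ∣ LambdaB p y) : ConjInO f invDiagTwo := by
  obtain ⟨j, hj⟩ := h.form_of_even hp
  obtain ⟨s, rfl⟩ : 2 ∣ s := h.pq ▸ hp q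
  have hpos := h.disc_pos hsig
  obtain ⟨y, z, hpy, hqy, hpz, hqz⟩ := h.exists_dual_vectors_of_even hp
  obtain ⟨m, n, e1, e2⟩ := h.exists_trace hf hff y
  obtain ⟨m', n', e3, e4⟩ := h.exists_trace hf hff z
  rw [hpy] at e1
  rw [hqy] at e2
  rw [hpz] at e3
  rw [hqz] at e4
  obtain ⟨D, hD⟩ : ∃ D, D = s ^ 2 - r * u := ⟨_, rfl⟩
  have hDpos : 0 < D := by linarith
  have hDr : D * n' = -r := by
    rw [hD]
    linear_combination s * (by linarith : m' * r + n' * s = 0)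
      - r * (by linarith : m' * s + n' * u = 1)
  have hD2 : D ∣ 2 := ⟨m' * n - m * n', by
    rw [hD]
    linear_combination -(m' * s + n' * u) * (by linarith : m * r + n * s = 2)
      + (m' * r + n' * s) * (by linarith : m * s + n * u = 0)
      - 2 * (by linarith : m' * s + n' * u = 1)⟩
  have hD1 : D = 1 := by
    have := Int.le_of_dvd (by norm_num) hD2
    obtain rfl | rfl : D = 1 ∨ D = 2 := by omega
    · rfl
    · omega
  obtain ⟨a, b, k, hab, hk0, hk1⟩ := h.exists_reduced (m := 2) two_pos (by linarith)
  obtain ⟨x, y, hxy⟩ := hab.span p h.left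
  have hform : 4 * (x * y) + 2 * k * (y * y) = -2 + 8 * j := by
    rw [← hj, ← h.pp, hxy, hab.form]
    ring
  obtain rfl | rfl : k = 0 ∨ k = 1 := by omega
  · exact absurd hform (by omega)
  have hy : Odd y := by
    have : Odd (y * y) := ⟨-1 + 2 * j - x * y, by linarith⟩
    exact (Int.odd_mul.mp this).1
  have hx : Odd x := by
    obtain ⟨i, hi⟩ := hy
    have : Odd (x * y) := ⟨j - i ^ 2 - i - 1, by rw [hi] at hform ⊢; linarith⟩
    exact (Int.odd_mul.mp this).1
  obtain ⟨g, hg⟩ : ∃ g, g = b - a := ⟨_, rfl⟩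
  have hge : InvGram f g b (-2) 0 2 := by
    have := hab.change (x := -1) (y := 1) (z := 0) (w := 1) (ε := -1) (r' := -2) (s' := 0)
      (u' := 2) (by norm_num) (by norm_num) (by norm_num) (by norm_num) (by norm_num)
    convert this using 1
    · rw [hg]; module
    · module
  have hpg : p = (x + y) • b - x • g := by rw [hxy, hg]; module
  have hgeven : ∀ v, 2 ∣ LambdaB g v := by
    intro v
    have h1 := hp v
    rw [hpg, map_sub, map_smul, map_smul, LinearMap.sub_apply, LinearMap.smul_apply,
      LinearMap.smul_apply, smul_eq_mul, smul_eq_mul] at h1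
    have h2 : 2 ∣ (x + y) * LambdaB b v := (hx.add_odd hy).two_dvd.mul_right _
    have h3 : Even (x * LambdaB g v) := even_iff_two_dvd.mpr ((dvd_sub_right h2).mp h1)
    rcases Int.even_mul.mp h3 with h4 | h4
    · exact absurd h4 (Int.not_even_iff_odd.mpr hx)
    · exact h4.two_dvd
  obtain ⟨-, w, -, -, hgw, hbw⟩ := hge.exists_dual_vectors_of_even hgeven
  exact conjInO_planeInvolution gramInv_diag_two hf hff hge.swap.toInvSpan
    (exists_isometry_diag hgeven hge.pp hge.qq hge.swap.pq hbw (by rw [LambdaB_symm, hgw]))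

/-- Every involution with invariant lattice of signature `(1,1)` is conjugate to one of the four
standard ones. -/
theorem conjInO_of_sigOneOne (hf : IsIsometry f) (hff : ∀ x, f (f x) = x)
    (hsig : SigOneOne (invLattice f)) :
    ConjInO f invU ∨ ConjInO f invU2 ∨ ConjInO f invDiagTwo ∨ ConjInO f invDiagOne := by
  by_cases H : ∀ t, f t = t → (∀ y, 2 ∣ LambdaB t y) → ∃ t', f t' = t' ∧ t = (2 : ℤ) • t'
  · have := conjInO_of_no_even hf hff hsig H
    tauto
  push Not at H
  obtain ⟨t, ht, hte, hno⟩ := H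
  obtain ⟨p, q, r, s, u, h⟩ := exists_invGram hsig
  obtain ⟨i, j, rfl⟩ := h.span t ht
  have hij : i ≠ 0 ∨ j ≠ 0 := by
    by_contra! hc
    exact hno 0 (map_zero f) (by rw [hc.1, hc.2]; simp)
  obtain ⟨d, i', j', x, y, -, rfl, rfl, hdet⟩ := exists_coprime_factor hij
  have hd : (d * i') • p + (d * j') • q = d • (i' • p + j' • q) := by module
  rw [hd] at hte hno
  have hdodd : Odd d := by
    rw [← Int.not_even_iff_odd]
    rintro ⟨c, rfl⟩
    exact hno (c • (i' • p + j' • q)) (by simp only [map_smul, map_add, h.left, h.right])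
      (by module)
  have heven : ∀ v, 2 ∣ LambdaB (i' • p + j' • q) v := by
    intro v
    have h1 := hte v
    rw [map_smul, LinearMap.smul_apply, smul_eq_mul, ← even_iff_two_dvd] at h1
    rcases Int.even_mul.mp h1 with h2 | h2
    · exact absurd h2 (Int.not_even_iff_odd.mpr hdodd)
    · exact h2.two_dvd
  have h' := h.change (x := i') (y := j') (z := y) (w := x)
    (r' := 2 * (r * i' * i' + s * i' * j' + u * j' * j'))
    (u' := 2 * (r * y * y + s * y * x + u * x * x)) (by norm_num) hdet (by ring) rfl (by ring)
  exact Or.inr (Or.inr (Or.inl (conjInO_of_even hf hff hsig h' heven)))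

end Classification

/-- **Classification of non-symplectic involutions with 19 parameters (lattice form).**
There are involutions `ι₁, ι₂, ι₃, ι₄ ∈ O(Λ)` of `Λ = U³ ⊕ E8² ⊕ ⟨−2⟩`, pairwise
non-conjugate in `O(Λ)`, each with invariant sublattice of signature `(1,1)`, such that
`Λ^{ι₁} ≅ U`, `Λ^{ι₂} ≅ U(2)`, `Λ^{ι₃} ≅ Λ^{ι₄} ≅ ⟨2⟩ ⊕ ⟨−2⟩`, the square `−2` element
of `Λ^{ι₃}` has divisibility `2` in `Λ` and the square `−2` element of `Λ^{ι₄}` has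
divisibility `1` in `Λ`; and every involution of `Λ` whose invariant sublattice has
signature `(1,1)` is conjugate in `O(Λ)` to exactly one of them (it is conjugate to at
least one, and the four are pairwise non-conjugate). -/
theorem four_conjugacy_classes :
    ∃ ι₁ ι₂ ι₃ ι₄ : LambdaM ≃ₗ[ℤ] LambdaM,
      (IsIsometry ι₁ ∧ ∀ x, ι₁ (ι₁ x) = x) ∧
      (IsIsometry ι₂ ∧ ∀ x, ι₂ (ι₂ x) = x) ∧
      (IsIsometry ι₃ ∧ ∀ x, ι₃ (ι₃ x) = x) ∧
      (IsIsometry ι₄ ∧ ∀ x, ι₄ (ι₄ x) = x) ∧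
      (¬ ConjInO ι₁ ι₂ ∧ ¬ ConjInO ι₁ ι₃ ∧ ¬ ConjInO ι₁ ι₄ ∧
        ¬ ConjInO ι₂ ι₃ ∧ ¬ ConjInO ι₂ ι₄ ∧ ¬ ConjInO ι₃ ι₄) ∧
      (SigOneOne (invLattice ι₁) ∧ SigOneOne (invLattice ι₂) ∧
        SigOneOne (invLattice ι₃) ∧ SigOneOne (invLattice ι₄)) ∧
      IsometricTo (invLattice ι₁) (gramBilin UGram) ∧
      IsometricTo (invLattice ι₂) (gramBilin U2Gram) ∧
      IsometricTo (invLattice ι₃) (gramBilin diag2Gram) ∧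
      IsometricTo (invLattice ι₄) (gramBilin diag2Gram) ∧
      (∀ g ∈ invLattice ι₃, LambdaB g g = -2 → HasDivisibility g 2) ∧
      (∀ g ∈ invLattice ι₄, LambdaB g g = -2 → HasDivisibility g 1) ∧
      (∀ ι : LambdaM ≃ₗ[ℤ] LambdaM, IsIsometry ι → (∀ x, ι (ι x) = x) →
        SigOneOne (invLattice ι) →
        (ConjInO ι ι₁ ∨ ConjInO ι ι₂ ∨ ConjInO ι ι₃ ∨ ConjInO ι ι₄)) := by
  refine ⟨invU, invU2, invDiagTwo, invDiagOne, isIsometry_planeInvolution _,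
    isIsometry_planeInvolution _, isIsometry_planeInvolution _, isIsometry_planeInvolution _,
    ⟨?_, ?_, ?_, ?_, ?_, ?_⟩, ⟨?_, ?_, ?_, ?_⟩, ?_, ?_, ?_, ?_, ?_, ?_, ?_⟩
  · exact not_conjInO_invU invGram_invU2 (by norm_num) (by norm_num) (by norm_num)
  · exact not_conjInO_invU invGram_invDiagTwo (by norm_num) (by norm_num) (by norm_num)
  · exact not_conjInO_invU invGram_invDiagOne (by norm_num) (by norm_num) (by norm_num)
  · exact not_conjInO_invU2 invGram_invDiagTwo
  · exact not_conjInO_invU2 invGram_invDiagOne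
  · exact not_conjInO_invDiagTwo
  · exact invGram_invU.sigOneOne (m := 1) (n := 1) (m' := 1) (n' := -1) (by norm_num) (by norm_num)
  · exact invGram_invU2.sigOneOne (m := 1) (n := 1) (m' := 1) (n' := -1) (by norm_num)
      (by norm_num)
  · exact invGram_invDiagTwo.sigOneOne (m := 1) (n := 0) (m' := 0) (n' := 1) (by norm_num)
      (by norm_num)
  · exact invGram_invDiagOne.sigOneOne (m := 1) (n := 0) (m' := 0) (n' := 1) (by norm_num)
      (by norm_num)
  · exact invGram_invU.isometricTo
  · exact invGram_invU2.isometricTo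
  · exact invGram_invDiagTwo.isometricTo
  · exact invGram_invDiagOne.isometricTo
  · exact invGram_invDiagTwo.hasDivisibility hasDivisibility_lamδ
  · exact invGram_invDiagOne.hasDivisibility hasDivisibility_diagOne
  · exact fun ι hf hff hsig => conjInO_of_sigOneOne hf hff hsig
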